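/- arXiv:2511.19247 — 2 statements merged into one kernel-verified Lean document; each statement's English description precedes it below -/
import Mathlib

section
/- Let n ≥ 1, p ≥ 1 and let 𝒮 = (S_0,…,S_{2n}) in 𝕊_p(ℝ) admit a representing measure. Fix t ∈ ℝ and m ∈ ℕ∪{0}, and let A, B ⊆ {1,…,p} be the index sets defined from the shifted moments T_i. Then the following are equivalent: (1) there exists a minimal representing measure μ for 𝒮 with mult_μ t = m; (2) Card A ≤ m ≤ Card(A ∪ B). -/
open Finset Matrix

/-- The block Hankel moment matrix `M(n) = (S_{i+j-2})_{i,j=1}^{n+1}` of a sequence of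
`p × p` real matrices. -/
def momentMatrix (n p : ℕ) (S : ℕ → Matrix (Fin p) (Fin p) ℝ) :
    Matrix (Fin (n + 1) × Fin p) (Fin (n + 1) × Fin p) ℝ :=
  fun ia jb => S (ia.1.1 + jb.1.1) ia.2 jb.2

/-- A (finitely atomic) representing measure for the truncated matrix sequence
`S_0, …, S_{2n}`: pairwise distinct atoms `x j` with nonzero psd masses `A j` such that
`S i = ∑ j (x j)^i • A j` for all `i ≤ 2n`. -/
def IsRepMeasure (n p : ℕ) (S : ℕ → Matrix (Fin p) (Fin p) ℝ) (ℓ : ℕ)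
    (x : Fin ℓ → ℝ) (A : Fin ℓ → Matrix (Fin p) (Fin p) ℝ) : Prop :=
  Function.Injective x ∧ (∀ j, (A j).PosSemidef) ∧ (∀ j, A j ≠ 0) ∧
    ∀ i, i ≤ 2 * n → S i = ∑ j, x j ^ i • A j

/-- Minimality: the sum of the ranks of the masses equals the rank of the moment matrix. -/
def IsMinimal (n p : ℕ) (S : ℕ → Matrix (Fin p) (Fin p) ℝ) {ℓ : ℕ}
    (A : Fin ℓ → Matrix (Fin p) (Fin p) ℝ) : Prop :=
  (∑ j, (A j).rank) = (momentMatrix n p S).rank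

/-- `mult_μ t = m`: either `t` is an atom whose mass has rank `m`, or `t` is not an atom
and `m = 0`. -/
def MultEq {p ℓ : ℕ} (x : Fin ℓ → ℝ) (A : Fin ℓ → Matrix (Fin p) (Fin p) ℝ)
    (t : ℝ) (m : ℕ) : Prop :=
  (∃ j, x j = t ∧ (A j).rank = m) ∨ ((∀ j, x j ≠ t) ∧ m = 0)

/-- The shifted moments `T_i = L((x - t)^i) = ∑_{ℓ=0}^{i} C(i,ℓ)(-1)^ℓ t^ℓ S_{i-ℓ}`. -/
def shiftT (p : ℕ) (t : ℝ) (S : ℕ → Matrix (Fin p) (Fin p) ℝ) (i : ℕ) :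
    Matrix (Fin p) (Fin p) ℝ :=
  ∑ l ∈ Finset.range (i + 1), ((i.choose l : ℝ) * (-1) ^ l * t ^ l) • S (i - l)

/-- The `j`-th column (1-based) of the `(n+1)p × (n+1)p` moment matrix `ℳ₁` of `T`. -/
def colM1 (n p : ℕ) (hp : 0 < p) (T : ℕ → Matrix (Fin p) (Fin p) ℝ) (j : ℕ) :
    Fin (n + 1) × Fin p → ℝ :=
  fun ia => T (ia.1.1 + (j - 1) / p) ia.2 ⟨(j - 1) % p, Nat.mod_lt _ hp⟩

/-- The `j`-th column (1-based) of the `np × (n+2)p` matrix `ℳ₂ = (T_{i+j-2})`. -/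
def colM2 (n p : ℕ) (hp : 0 < p) (T : ℕ → Matrix (Fin p) (Fin p) ℝ) (j : ℕ) :
    Fin n × Fin p → ℝ :=
  fun ia => T (ia.1.1 + (j - 1) / p) ia.2 ⟨(j - 1) % p, Nat.mod_lt _ hp⟩

/-- The index set `A` of Theorem 1.1. -/
def setA (n p : ℕ) (hp : 0 < p) (T : ℕ → Matrix (Fin p) (Fin p) ℝ) : Set ℕ :=
  {i | i ∈ Set.Icc 1 p ∧ ∃ k ∈ Set.Icc 1 n,
    colM1 n p hp T (k * p + i) ∈
      Submodule.span ℝ (colM1 n p hp T '' Set.Icc (p + 1) (k * p + i - 1)) ∧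
    colM1 n p hp T ((k - 1) * p + i) ∉
      Submodule.span ℝ (colM1 n p hp T '' Set.Icc 1 ((k - 1) * p + i - 1))}

/-- The index set `B` of Theorem 1.1. -/
def setB (n p : ℕ) (hp : 0 < p) (T : ℕ → Matrix (Fin p) (Fin p) ℝ) : Set ℕ :=
  {i | i ∈ Set.Icc 1 p ∧
    colM2 n p hp T ((n + 1) * p + i) ∈
      Submodule.span ℝ (colM2 n p hp T '' Set.Icc (p + 1) ((n + 1) * p + i - 1)) ∧
    colM1 n p hp T (n * p + i) ∉
      Submodule.span ℝ (colM1 n p hp T '' Set.Icc 1 (n * p + i - 1))}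


section Extension

open Module

variable {E F : Type*} [NormedAddCommGroup E] [InnerProductSpace ℝ E]
  [AddCommGroup F] [Module ℝ F]

/-- The symmetric perturbation `Y + s ⟪g, ·⟫ g` of an endomorphism `Y`. -/
noncomputable def rankOnePerturb (Y : E →ₗ[ℝ] E) (s : ℝ) (g : E) : E →ₗ[ℝ] E :=
  Y + s • (innerₛₗ ℝ g).smulRight g

theorem rankOnePerturb_apply (Y : E →ₗ[ℝ] E) (s : ℝ) (g u : E) :
    rankOnePerturb Y s g u = Y u + (s * inner ℝ g u) • g := by
  simp [rankOnePerturb, smul_smul]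

theorem rankOnePerturb_isSymmetric {Y : E →ₗ[ℝ] E} (hY : Y.IsSymmetric) (s : ℝ) (g : E) :
    (rankOnePerturb Y s g).IsSymmetric := by
  intro u w
  simp only [rankOnePerturb_apply, inner_add_left, inner_add_right, inner_smul_left,
    inner_smul_right, hY u w, RCLike.conj_to_real, real_inner_comm u g]
  ring

theorem rankOnePerturb_eq_of_mem {Y : E →ₗ[ℝ] E} {s : ℝ} {D : Submodule ℝ E} {g u : E}
    (hg : g ∈ Dᗮ) (hu : u ∈ D) : rankOnePerturb Y s g u = Y u := by
  rw [rankOnePerturb_apply, Submodule.inner_left_of_mem_orthogonal hu hg]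
  simp

/-- For symmetric `Y`, the space of `w` with `Y w ⊥ D` is the orthogonal complement of `Y D`. -/
theorem ker_comp_eq_orthogonal_map {Y : E →ₗ[ℝ] E} (hY : Y.IsSymmetric) {D : Submodule ℝ E}
    {Φ : E →ₗ[ℝ] F} (hΦ : LinearMap.ker Φ = Dᗮ) :
    LinearMap.ker (Φ ∘ₗ Y) = (D.map Y)ᗮ := by
  ext w
  rw [LinearMap.ker_comp, hΦ, Submodule.mem_comap, Submodule.mem_orthogonal,
    Submodule.mem_orthogonal]
  constructor
  · rintro h _ ⟨d, hd, rfl⟩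
    rw [hY]
    exact h d hd
  · intro h d hd
    rw [← hY]
    exact h _ ⟨d, hd, rfl⟩

variable [FiniteDimensional ℝ E]

theorem finrank_ker_inf_orthogonal_singleton {K : Submodule ℝ E} {g u : E} (hu : u ∈ K)
    (hgu : inner ℝ g u ≠ 0) :
    finrank ℝ (K ⊓ LinearMap.ker (innerₛₗ ℝ g) : Submodule ℝ E) + 1 = finrank ℝ K := by
  have h := LinearMap.finrank_range_add_finrank_ker ((innerₛₗ ℝ g).domRestrict K)
  have hr : LinearMap.range ((innerₛₗ ℝ g).domRestrict K) = ⊤ := by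
    apply LinearMap.range_eq_top.2
    intro c
    refine ⟨(c / inner ℝ g u) • ⟨u, hu⟩, ?_⟩
    simp [hgu]
  have hk : finrank ℝ (LinearMap.ker ((innerₛₗ ℝ g).domRestrict K)) =
      finrank ℝ (K ⊓ LinearMap.ker (innerₛₗ ℝ g) : Submodule ℝ E) := by
    rw [LinearMap.domRestrict, LinearMap.ker_comp, ← Submodule.finrank_map_subtype_eq,
      Submodule.map_comap_subtype]
  rw [hr, hk, finrank_top, finrank_self] at h
  omega

theorem finrank_map_add_finrank_inf_ker (f : E →ₗ[ℝ] F) (U : Submodule ℝ E) :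
    finrank ℝ (U.map f) + finrank ℝ (U ⊓ LinearMap.ker f : Submodule ℝ E) = finrank ℝ U := by
  have h := LinearMap.finrank_range_add_finrank_ker (f.domRestrict U)
  rw [LinearMap.range_domRestrict] at h
  rw [← h, LinearMap.domRestrict, LinearMap.ker_comp, ← Submodule.finrank_map_subtype_eq,
      Submodule.map_comap_subtype]

theorem exists_extension_finrank_ker_pred {Y : E →ₗ[ℝ] E} (hY : Y.IsSymmetric)
    {D : Submodule ℝ E} (h : finrank ℝ D < finrank ℝ (LinearMap.ker Y) + finrank ℝ (D.map Y)) :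
    ∃ Y' : E →ₗ[ℝ] E, Y'.IsSymmetric ∧ (∀ d ∈ D, Y' d = Y d) ∧
      finrank ℝ (LinearMap.ker Y') + 1 = finrank ℝ (LinearMap.ker Y) := by
  obtain ⟨u, hu, huD⟩ : ∃ u ∈ LinearMap.ker Y, u ∉ D := by
    by_contra! hcon
    have h1 := finrank_map_add_finrank_inf_ker Y D
    rw [inf_eq_right.2 hcon] at h1
    omega
  obtain ⟨d, hd, g, hg, rfl⟩ := D.exists_add_mem_mem_orthogonal u
  have hgg : inner ℝ g (d + g) = inner ℝ g g := by
    rw [inner_add_right, Submodule.inner_left_of_mem_orthogonal hd hg, zero_add]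
  have hg0 : inner ℝ g (d + g) ≠ 0 := by
    rw [hgg]
    intro h0
    rw [inner_self_eq_zero] at h0
    exact huD (by simpa [h0] using hd)
  refine ⟨rankOnePerturb Y 1 g, rankOnePerturb_isSymmetric hY _ _,
    fun x hx => rankOnePerturb_eq_of_mem hg hx, ?_⟩
  rw [← finrank_ker_inf_orthogonal_singleton hu hg0]
  suffices hker : LinearMap.ker (rankOnePerturb Y 1 g) =
      LinearMap.ker Y ⊓ LinearMap.ker (innerₛₗ ℝ g) by rw [hker]
  ext w
  simp only [LinearMap.mem_ker, rankOnePerturb_apply, Submodule.mem_inf, innerₛₗ_apply_apply]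
  constructor
  · intro hw
    have h1 : inner ℝ (d + g) (Y w + (1 * inner ℝ g w) • g) = 0 := by rw [hw, inner_zero_right]
    rw [inner_add_right, ← hY, LinearMap.mem_ker.1 hu, inner_zero_left, inner_smul_right,
      real_inner_comm g (d + g), zero_add, one_mul] at h1
    have h2 := (mul_eq_zero.1 h1).resolve_right hg0
    exact ⟨by simpa [h2] using hw, h2⟩
  · rintro ⟨h1, h2⟩
    simp [h1, h2]

/-- Comparing `dim ker Y` with the bound is the same as comparing `Y D ∩ Dᗮ` with
`ran Y ∩ Dᗮ`. -/
theorem finrank_ker_balance (Y : E →ₗ[ℝ] E) (D : Submodule ℝ E) (Φ : E →ₗ[ℝ] F) :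
    finrank ℝ (LinearMap.ker Y) + finrank ℝ (D.map Y) + finrank ℝ (LinearMap.range (Φ ∘ₗ Y)) +
        finrank ℝ (LinearMap.range Y ⊓ LinearMap.ker Φ : Submodule ℝ E) =
      finrank ℝ E + finrank ℝ (D.map (Φ ∘ₗ Y)) +
        finrank ℝ (D.map Y ⊓ LinearMap.ker Φ : Submodule ℝ E) := by
  have h1 := finrank_map_add_finrank_inf_ker Φ (LinearMap.range Y)
  have h2 := finrank_map_add_finrank_inf_ker Φ (D.map Y)
  have h3 := LinearMap.finrank_range_add_finrank_ker Y
  rw [← LinearMap.range_comp] at h1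
  rw [← Submodule.map_comp] at h2
  omega

theorem exists_extension_finrank_ker_succ {Y : E →ₗ[ℝ] E} (hY : Y.IsSymmetric)
    {D : Submodule ℝ E} {Φ : E →ₗ[ℝ] F} (hΦ : LinearMap.ker Φ = Dᗮ)
    (h : finrank ℝ (LinearMap.ker Y) + finrank ℝ (D.map Y) +
      finrank ℝ (LinearMap.range (Φ ∘ₗ Y)) < finrank ℝ E + finrank ℝ (D.map (Φ ∘ₗ Y))) :
    ∃ Y' : E →ₗ[ℝ] E, Y'.IsSymmetric ∧ (∀ d ∈ D, Y' d = Y d) ∧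
      finrank ℝ (LinearMap.ker Y') = finrank ℝ (LinearMap.ker Y) + 1 := by
  obtain ⟨u, hu, huu⟩ : ∃ u, Y u ∈ Dᗮ ∧ inner ℝ (Y u) u ≠ 0 := by
    by_contra! hcon
    have hpol : ∀ u w, Y u ∈ Dᗮ → Y w ∈ Dᗮ → inner ℝ (Y u) w = 0 := by
      intro u w hu hw
      have h1 := hcon (u + w) (by rw [map_add]; exact add_mem hu hw)
      rw [map_add, inner_add_left, inner_add_right, inner_add_right, hcon u hu, hcon w hw,
        hY w u, real_inner_comm (Y u) w] at h1
      linarith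
    have hle : LinearMap.range Y ⊓ LinearMap.ker Φ ≤ D.map Y ⊓ LinearMap.ker Φ := by
      rintro _ ⟨⟨u, rfl⟩, hu⟩
      refine ⟨?_, hu⟩
      rw [SetLike.mem_coe, hΦ] at hu
      rw [SetLike.mem_coe, ← Submodule.orthogonal_orthogonal (D.map Y),
        ← ker_comp_eq_orthogonal_map hY hΦ, LinearMap.ker_comp, hΦ]
      intro w hw
      rw [real_inner_comm]
      exact hpol u w hu hw
    have h1 := Submodule.finrank_mono hle
    have h2 := finrank_ker_balance Y D Φ
    omega
  refine ⟨rankOnePerturb Y (-(inner ℝ (Y u) u)⁻¹) (Y u), rankOnePerturb_isSymmetric hY _ _,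
    fun x hx => rankOnePerturb_eq_of_mem hu hx, ?_⟩
  have hmem : u ∈ LinearMap.ker (rankOnePerturb Y (-(inner ℝ (Y u) u)⁻¹) (Y u)) := by
    simp [rankOnePerturb_apply, huu]
  rw [← finrank_ker_inf_orthogonal_singleton hmem huu]
  suffices hker : LinearMap.ker (rankOnePerturb Y (-(inner ℝ (Y u) u)⁻¹) (Y u)) ⊓
      LinearMap.ker (innerₛₗ ℝ (Y u)) = LinearMap.ker Y by rw [hker]
  ext w
  simp only [LinearMap.mem_ker, rankOnePerturb_apply, Submodule.mem_inf, innerₛₗ_apply_apply]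
  constructor
  · rintro ⟨h1, h2⟩
    simpa [h2] using h1
  · intro hw
    have h2 : inner ℝ (Y u) w = 0 := by rw [hY, hw, inner_zero_right]
    simp [hw, h2]

/-- The possible kernel dimensions of symmetric extensions of the restriction of a symmetric
endomorphism `Y₀` to a subspace `D`. -/
theorem exists_extension_finrank_ker_iff {Y₀ : E →ₗ[ℝ] E} (hY₀ : Y₀.IsSymmetric)
    {D : Submodule ℝ E} {Φ : E →ₗ[ℝ] F} (hΦ : LinearMap.ker Φ = Dᗮ) (m : ℕ) :
    (∃ Y : E →ₗ[ℝ] E, Y.IsSymmetric ∧ (∀ d ∈ D, Y d = Y₀ d) ∧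
      finrank ℝ (LinearMap.ker Y) = m) ↔
    finrank ℝ D ≤ m + finrank ℝ (D.map Y₀) ∧
      m + finrank ℝ (D.map Y₀) + finrank ℝ (LinearMap.range (Φ ∘ₗ Y₀)) ≤
        finrank ℝ E + finrank ℝ (D.map (Φ ∘ₗ Y₀)) := by
  have hinv : ∀ Y : E →ₗ[ℝ] E, Y.IsSymmetric → (∀ d ∈ D, Y d = Y₀ d) →
      D.map Y = D.map Y₀ ∧ D.map (Φ ∘ₗ Y) = D.map (Φ ∘ₗ Y₀) ∧
      finrank ℝ (LinearMap.range (Φ ∘ₗ Y)) = finrank ℝ (LinearMap.range (Φ ∘ₗ Y₀)) := by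
    intro Y hY hD
    have h1 : D.map Y = D.map Y₀ := by
      ext y
      simp only [Submodule.mem_map]
      exact exists_congr fun d => and_congr_right fun hd => by rw [hD d hd]
    refine ⟨h1, by rw [Submodule.map_comp, h1, Submodule.map_comp], ?_⟩
    have h2 := LinearMap.finrank_range_add_finrank_ker (Φ ∘ₗ Y)
    have h3 := LinearMap.finrank_range_add_finrank_ker (Φ ∘ₗ Y₀)
    rw [ker_comp_eq_orthogonal_map hY hΦ, h1] at h2
    rw [ker_comp_eq_orthogonal_map hY₀ hΦ] at h3
    omega
  constructor
  · rintro ⟨Y, hY, hD, rfl⟩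
    obtain ⟨h1, h2, h3⟩ := hinv Y hY hD
    rw [← h1, ← h2, ← h3]
    have h4 := finrank_map_add_finrank_inf_ker Y D
    have h5 := Submodule.finrank_mono (inf_le_right : D ⊓ LinearMap.ker Y ≤ _)
    have h6 := finrank_ker_balance Y D Φ
    have h7 := Submodule.finrank_mono
      (inf_le_inf_right (LinearMap.ker Φ) (LinearMap.map_le_range (f := Y) (p := D)))
    omega
  · rintro ⟨hlo, hhi⟩
    have down : ∀ k, ∀ Y : E →ₗ[ℝ] E, Y.IsSymmetric → (∀ d ∈ D, Y d = Y₀ d) →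
        finrank ℝ (LinearMap.ker Y) = m + k → ∃ Y : E →ₗ[ℝ] E, Y.IsSymmetric ∧
          (∀ d ∈ D, Y d = Y₀ d) ∧ finrank ℝ (LinearMap.ker Y) = m := by
      intro k
      induction k with
      | zero => exact fun Y hY hD hk => ⟨Y, hY, hD, hk⟩
      | succ k ih =>
        intro Y hY hD hk
        obtain ⟨Y', hY', hD', hk'⟩ := exists_extension_finrank_ker_pred hY (D := D) (by
          rw [(hinv Y hY hD).1]
          omega)
        exact ih Y' hY' (fun d hd => (hD' d hd).trans (hD d hd)) (by omega)
    have up : ∀ k, ∀ Y : E →ₗ[ℝ] E, Y.IsSymmetric → (∀ d ∈ D, Y d = Y₀ d) →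
        finrank ℝ (LinearMap.ker Y) + k = m → ∃ Y : E →ₗ[ℝ] E, Y.IsSymmetric ∧
          (∀ d ∈ D, Y d = Y₀ d) ∧ finrank ℝ (LinearMap.ker Y) = m := by
      intro k
      induction k with
      | zero => exact fun Y hY hD hk => ⟨Y, hY, hD, hk⟩
      | succ k ih =>
        intro Y hY hD hk
        obtain ⟨h1, h2, h3⟩ := hinv Y hY hD
        obtain ⟨Y', hY', hD', hk'⟩ := exists_extension_finrank_ker_succ hY hΦ (by
          rw [h1, h2, h3]
          omega)
        exact ih Y' hY' (fun d hd => (hD' d hd).trans (hD d hd)) (by omega)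
    rcases le_total m (finrank ℝ (LinearMap.ker Y₀)) with h | h
    · exact down _ Y₀ hY₀ (fun _ _ => rfl) (Nat.add_sub_of_le h).symm
    · exact up _ Y₀ hY₀ (fun _ _ => rfl) (Nat.add_sub_of_le h)

end Extension

section Counting

open Module

variable {E F : Type*} [AddCommGroup E] [Module ℝ E] [AddCommGroup F] [Module ℝ F]

/-- The span of the first `j` terms of a sequence. -/
def initialSpan (w : ℕ → E) (j : ℕ) : Submodule ℝ E :=
  Submodule.span ℝ (w '' Set.Iio j)

theorem initialSpan_zero (w : ℕ → E) : initialSpan w 0 = ⊥ := by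
  simp [initialSpan]

theorem initialSpan_succ (w : ℕ → E) (j : ℕ) :
    initialSpan w (j + 1) = initialSpan w j ⊔ Submodule.span ℝ {w j} := by
  have h : Set.Iio (j + 1) = Set.Iio j ∪ {j} := by
    ext a
    simp only [Set.mem_Iio, Set.union_singleton, Set.mem_insert_iff]
    omega
  rw [initialSpan, h, Set.image_union, Submodule.span_union, Set.image_singleton, initialSpan]

theorem finrank_sup_span_singleton_of_notMem [FiniteDimensional ℝ E] {U : Submodule ℝ E} {u : E}
    (hu : u ∉ U) : finrank ℝ (U ⊔ Submodule.span ℝ {u} : Submodule ℝ E) = finrank ℝ U + 1 := by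
  have hu0 : u ≠ 0 := fun h => hu (h ▸ U.zero_mem)
  have h := Submodule.finrank_sup_add_finrank_inf_eq U (Submodule.span ℝ {u})
  have hd : U ⊓ Submodule.span ℝ {u} = ⊥ :=
    ((Submodule.disjoint_span_singleton' hu0).2 hu).eq_bot
  rw [hd, finrank_bot, finrank_span_singleton hu0] at h
  omega

open Classical in
/-- The number of indices at which the span of a sequence grows while the span of its image
under `f` does not, expressed by dimensions. -/
theorem card_jump_add [FiniteDimensional ℝ E] [FiniteDimensional ℝ F] (w : ℕ → E)
    (f : E →ₗ[ℝ] F) {a b : ℕ} (hab : a ≤ b) :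
    ((Finset.Ico a b).filter fun j => w j ∉ initialSpan w j ∧
        f (w j) ∈ (initialSpan w j).map f).card +
      finrank ℝ ((initialSpan w b).map f) + finrank ℝ (initialSpan w a) =
    finrank ℝ (initialSpan w b) + finrank ℝ ((initialSpan w a).map f) := by
  induction b, hab using Nat.le_induction with
  | base => simp [add_comm]
  | succ b hab ih =>
    rw [← Finset.insert_Ico_right_eq_Ico_add_one hab, Finset.filter_insert, initialSpan_succ,
      Submodule.map_sup, Submodule.map_span, Set.image_singleton]
    by_cases h1 : w b ∈ initialSpan w b
    · have h2 := Submodule.mem_map_of_mem (f := f) h1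
      rw [if_neg (by simp [h1]), sup_eq_left.2 ((Submodule.span_singleton_le_iff_mem _ _).2 h1),
        sup_eq_left.2 ((Submodule.span_singleton_le_iff_mem _ _).2 h2)]
      exact ih
    · rw [finrank_sup_span_singleton_of_notMem h1]
      by_cases h2 : f (w b) ∈ (initialSpan w b).map f
      · rw [if_pos ⟨h1, h2⟩, Finset.card_insert_of_notMem (by simp),
          sup_eq_left.2 ((Submodule.span_singleton_le_iff_mem _ _).2 h2)]
        omega
      · rw [if_neg (by simp [h2]), finrank_sup_span_singleton_of_notMem h2]
        omega

end Counting

section Krylov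

open Module

variable {E : Type*} [NormedAddCommGroup E] [InnerProductSpace ℝ E] {p : ℕ}

/-- The span of the vectors `X ^ k (e i)` with `k < N`. -/
def krylov (N : ℕ) (X : E →ₗ[ℝ] E) (e : Fin p → E) : Submodule ℝ E :=
  Submodule.span ℝ (Set.range fun q : Fin N × Fin p => (X ^ q.1.1) (e q.2))

/-- The inner products with the vectors `X ^ k (e i)`, `k < N`. -/
noncomputable def krylovTest (N : ℕ) (X : E →ₗ[ℝ] E) (e : Fin p → E) :
    E →ₗ[ℝ] (Fin N × Fin p → ℝ) :=
  LinearMap.pi fun q => innerₛₗ ℝ ((X ^ q.1.1) (e q.2))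

theorem krylovTest_apply (N : ℕ) (X : E →ₗ[ℝ] E) (e : Fin p → E) (u : E) (q : Fin N × Fin p) :
    krylovTest N X e u q = inner ℝ ((X ^ q.1.1) (e q.2)) u := rfl

theorem ker_krylovTest (N : ℕ) (X : E →ₗ[ℝ] E) (e : Fin p → E) :
    LinearMap.ker (krylovTest N X e) = (krylov N X e)ᗮ := by
  ext u
  rw [LinearMap.mem_ker, krylov, Submodule.mem_orthogonal]
  constructor
  · intro h v hv
    induction hv using Submodule.span_induction with
    | mem v hv =>
      obtain ⟨q, rfl⟩ := hv
      exact congrFun h q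
    | zero => exact inner_zero_left _
    | add v w _ _ hv hw => rw [inner_add_left, hv, hw, add_zero]
    | smul c v _ hv => rw [inner_smul_left, hv, mul_zero]
  · intro h
    ext q
    exact h _ (Submodule.subset_span ⟨q, rfl⟩)

theorem mem_krylov {N : ℕ} {X : E →ₗ[ℝ] E} {e : Fin p → E} {k : ℕ} (hk : k < N) (i : Fin p) :
    (X ^ k) (e i) ∈ krylov N X e :=
  Submodule.subset_span ⟨(⟨k, hk⟩, i), rfl⟩

/-- The vectors `X ^ k (e i)` listed in the order of the columns of a block matrix. -/
def krylovSeq (hp : 0 < p) (X : E →ₗ[ℝ] E) (e : Fin p → E) (j : ℕ) : E :=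
  (X ^ (j / p)) (e ⟨j % p, Nat.mod_lt _ hp⟩)

theorem apply_krylovSeq (hp : 0 < p) (X : E →ₗ[ℝ] E) (e : Fin p → E) (j : ℕ) :
    X (krylovSeq hp X e j) = krylovSeq hp X e (j + p) := by
  simp [krylovSeq, Nat.add_div_right _ hp, pow_succ']

theorem initialSpan_krylovSeq (hp : 0 < p) (X : E →ₗ[ℝ] E) (e : Fin p → E) (N : ℕ) :
    initialSpan (krylovSeq hp X e) (N * p) = krylov N X e := by
  rw [initialSpan, krylov]
  congr 1
  ext u
  constructor
  · rintro ⟨j, hj, rfl⟩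
    exact ⟨(⟨j / p, Nat.div_lt_of_lt_mul (by rw [mul_comm]; exact hj)⟩, ⟨j % p, Nat.mod_lt _ hp⟩),
      rfl⟩
  · rintro ⟨⟨k, i⟩, rfl⟩
    refine ⟨k.1 * p + i.1, ?_, ?_⟩
    · have := Nat.mul_le_mul_right p (Nat.succ_le_of_lt k.2)
      have := i.2
      rw [Nat.succ_mul] at *
      simp only [Set.mem_Iio]
      omega
    · have h1 : (k.1 * p + i.1) / p = k.1 := by
        rw [mul_comm, Nat.mul_add_div hp, Nat.div_eq_of_lt i.2, add_zero]
      have h2 : (k.1 * p + i.1) % p = i.1 := by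
        rw [mul_comm, Nat.mul_add_mod, Nat.mod_eq_of_lt i.2]
      simp only [krylovSeq, h1, h2, Fin.eta]

theorem map_initialSpan_krylovSeq_le (hp : 0 < p) (X : E →ₗ[ℝ] E) (e : Fin p → E) (j : ℕ) :
    (initialSpan (krylovSeq hp X e) j).map X ≤ initialSpan (krylovSeq hp X e) (j + p) := by
  rw [initialSpan, Submodule.map_span, Submodule.span_le]
  rintro _ ⟨_, ⟨a, ha, rfl⟩, rfl⟩
  rw [apply_krylovSeq]
  exact Submodule.subset_span ⟨a + p, Nat.add_lt_add_right ha p, rfl⟩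

theorem krylovSeq_add_mul_mem (hp : 0 < p) {X : E →ₗ[ℝ] E} {e : Fin p → E} {j : ℕ}
    (h : X (krylovSeq hp X e j) ∈ (initialSpan (krylovSeq hp X e) j).map X) (l : ℕ) :
    krylovSeq hp X e (j + (l + 1) * p) ∈ initialSpan (krylovSeq hp X e) (j + (l + 1) * p) := by
  induction l with
  | zero =>
    rw [apply_krylovSeq] at h
    simpa using map_initialSpan_krylovSeq_le hp X e j h
  | succ l ih =>
    have h1 := map_initialSpan_krylovSeq_le hp X e _ (Submodule.mem_map_of_mem (f := X) ih)
    rw [apply_krylovSeq] at h1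
    rw [add_mul (l + 1) 1, one_mul, ← add_assoc]
    exact h1

/-- `X` is symmetric and `S k = (⟪e i, X ^ k (e j)⟫)` for `k ≤ 2 n`. -/
def IsOperatorModel (n : ℕ) (S : ℕ → Matrix (Fin p) (Fin p) ℝ) (X : E →ₗ[ℝ] E)
    (e : Fin p → E) : Prop :=
  X.IsSymmetric ∧ ∀ k, k ≤ 2 * n → ∀ i j, S k i j = inner ℝ (e i) ((X ^ k) (e j))

theorem IsOperatorModel.inner_pow_pow {n : ℕ} {S : ℕ → Matrix (Fin p) (Fin p) ℝ}
    {X : E →ₗ[ℝ] E} {e : Fin p → E} (h : IsOperatorModel n S X e) {a b : ℕ}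
    (hab : a + b ≤ 2 * n) (i j : Fin p) :
    inner ℝ ((X ^ a) (e i)) ((X ^ b) (e j)) = S (a + b) i j := by
  rw [h.2 _ hab, h.1.pow a, pow_add, Module.End.mul_apply]

/-- Only the action of `X` on `krylov n X e` matters for the moments. -/
theorem IsOperatorModel.of_eqOn {n : ℕ} {S : ℕ → Matrix (Fin p) (Fin p) ℝ}
    {X Y : E →ₗ[ℝ] E} {e : Fin p → E} (h : IsOperatorModel n S X e) (hY : Y.IsSymmetric)
    (hXY : ∀ d ∈ krylov n X e, Y d = X d) :
    IsOperatorModel n S Y e ∧ krylov (n + 1) Y e = krylov (n + 1) X e := by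
  have hpow : ∀ k, k ≤ n → ∀ i, (Y ^ k) (e i) = (X ^ k) (e i) := by
    intro k
    induction k with
    | zero => simp
    | succ k ih =>
      intro hk i
      rw [pow_succ', Module.End.mul_apply, ih (by omega), hXY _ (mem_krylov (by omega) i),
        pow_succ', Module.End.mul_apply]
  refine ⟨⟨hY, fun k hk i j => ?_⟩, ?_⟩
  · obtain ⟨a, b, ha, hb, rfl⟩ : ∃ a b, a ≤ n ∧ b ≤ n ∧ k = a + b :=
      ⟨k / 2, k - k / 2, by omega, by omega, by omega⟩
    rw [← h.inner_pow_pow hk, pow_add, Module.End.mul_apply, ← hY.pow a, hpow a ha, hpow b hb]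
  · rw [krylov, krylov]
    congr 2
    ext q
    exact hpow _ (by omega) _

end Krylov

section IndexSets

open Module

variable {E : Type*} [NormedAddCommGroup E] [InnerProductSpace ℝ E] {n p : ℕ}
  {T : ℕ → Matrix (Fin p) (Fin p) ℝ} {Y : E →ₗ[ℝ] E} {e : Fin p → E}

theorem colM1_eq_krylovTest (hp : 0 < p) (h : IsOperatorModel n T Y e) {j : ℕ}
    (hj : j < (n + 1) * p) :
    colM1 n p hp T (j + 1) = krylovTest (n + 1) Y e (krylovSeq hp Y e j) := by
  ext q
  have h1 : j / p < n + 1 := Nat.div_lt_of_lt_mul (by rwa [mul_comm])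
  rw [krylovTest_apply, krylovSeq, h.inner_pow_pow (by omega)]
  rfl

theorem colM2_eq_krylovTest (hp : 0 < p) (h : IsOperatorModel n T Y e) {j : ℕ}
    (hj : j < (n + 1) * p) :
    colM2 n p hp T (j + p + 1) = (krylovTest n Y e ∘ₗ Y) (krylovSeq hp Y e j) := by
  ext q
  have h1 : j / p < n + 1 := Nat.div_lt_of_lt_mul (by rwa [mul_comm])
  have h2 : (j + p) / p = j / p + 1 := Nat.add_div_right _ hp
  rw [LinearMap.comp_apply, apply_krylovSeq, krylovTest_apply, krylovSeq,
    h.inner_pow_pow (by omega)]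
  rfl

theorem span_image_Icc_eq_map {F : Type*} [AddCommGroup F] [Module ℝ F] {c : ℕ → F}
    {w : ℕ → E} {f : E →ₗ[ℝ] F} {s j : ℕ} (h : ∀ a < j, c (a + s + 1) = f (w a)) :
    Submodule.span ℝ (c '' Set.Icc (s + 1) (j + s)) = (initialSpan w j).map f := by
  rw [initialSpan, Submodule.map_span, Set.image_image]
  congr 1
  ext u
  constructor
  · rintro ⟨a, ⟨h1, h2⟩, rfl⟩
    refine ⟨a - s - 1, by simp only [Set.mem_Iio]; omega, ?_⟩
    simp only
    rw [← h _ (by omega)]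
    congr 1
    omega
  · rintro ⟨a, ha, rfl⟩
    rw [Set.mem_Iio] at ha
    exact ⟨a + s + 1, ⟨by omega, by omega⟩, h a ha⟩

theorem krylovTest_injective (hspan : krylov (n + 1) Y e = ⊤) :
    Function.Injective (krylovTest (n + 1) Y e) := by
  rw [← LinearMap.ker_eq_bot, ker_krylovTest, hspan, Submodule.top_orthogonal_eq_bot]

theorem colM1_notMem_iff (hp : 0 < p) (h : IsOperatorModel n T Y e)
    (hspan : krylov (n + 1) Y e = ⊤) {j : ℕ} (hj : j < (n + 1) * p) :
    colM1 n p hp T (j + 1) ∉ Submodule.span ℝ (colM1 n p hp T '' Set.Icc 1 j) ↔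
      krylovSeq hp Y e j ∉ initialSpan (krylovSeq hp Y e) j := by
  have h1 := span_image_Icc_eq_map (c := colM1 n p hp T) (w := krylovSeq hp Y e)
    (f := krylovTest (n + 1) Y e) (s := 0) (j := j)
    (fun a ha => colM1_eq_krylovTest hp h (ha.trans hj))
  simp only [zero_add, add_zero] at h1
  rw [h1, colM1_eq_krylovTest hp h hj]
  exact not_congr ((krylovTest_injective hspan).mem_set_image
    (s := (initialSpan (krylovSeq hp Y e) j : Set E)))

theorem colM1_shift_mem_iff (hp : 0 < p) (h : IsOperatorModel n T Y e)
    (hspan : krylov (n + 1) Y e = ⊤) {j : ℕ} (hj : j < n * p) :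
    colM1 n p hp T (j + p + 1) ∈
        Submodule.span ℝ (colM1 n p hp T '' Set.Icc (p + 1) (j + p)) ↔
      Y (krylovSeq hp Y e j) ∈ (initialSpan (krylovSeq hp Y e) j).map Y := by
  have hcol : ∀ a ≤ j, colM1 n p hp T (a + p + 1) =
      (krylovTest (n + 1) Y e ∘ₗ Y) (krylovSeq hp Y e a) := by
    intro a ha
    rw [colM1_eq_krylovTest hp h (by rw [add_mul]; omega), LinearMap.comp_apply, apply_krylovSeq]
  rw [span_image_Icc_eq_map (fun a ha => hcol a ha.le), hcol j le_rfl, Submodule.map_comp,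
    LinearMap.comp_apply]
  exact (krylovTest_injective hspan).mem_set_image
    (s := ((initialSpan (krylovSeq hp Y e) j).map Y : Set E))

theorem colM2_shift_mem_iff (hp : 0 < p) (h : IsOperatorModel n T Y e)
    {j : ℕ} (hj : j < (n + 1) * p) :
    colM2 n p hp T (j + p + 1) ∈
        Submodule.span ℝ (colM2 n p hp T '' Set.Icc (p + 1) (j + p)) ↔
      (krylovTest n Y e ∘ₗ Y) (krylovSeq hp Y e j) ∈
        (initialSpan (krylovSeq hp Y e) j).map (krylovTest n Y e ∘ₗ Y) := by
  rw [span_image_Icc_eq_map (fun a ha => colM2_eq_krylovTest hp h (ha.trans hj)),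
    colM2_eq_krylovTest hp h hj]

open Classical in
theorem ncard_setA_add [FiniteDimensional ℝ E] (hp : 0 < p) (h : IsOperatorModel n T Y e)
    (hspan : krylov (n + 1) Y e = ⊤) :
    (setA n p hp T).ncard + finrank ℝ ((krylov n Y e).map Y) = finrank ℝ (krylov n Y e) := by
  have hcount := card_jump_add (krylovSeq hp Y e) Y (Nat.zero_le (n * p))
  rw [initialSpan_zero, Submodule.map_bot, finrank_bot, add_zero, add_zero,
    initialSpan_krylovSeq] at hcount
  rw [← hcount]
  congr 1
  rw [← Finset.card_image_of_injOn (f := fun j => j % p + 1), ← Set.ncard_coe_finset]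
  · congr 1
    ext i
    simp only [setA, Set.mem_ofPred_eq, Finset.coe_image, Finset.coe_filter, Finset.mem_Ico,
      Set.mem_image, Set.mem_Icc]
    constructor
    · rintro ⟨⟨hi1, hip⟩, k, ⟨hk1, hkn⟩, hmem, hnot⟩
      obtain ⟨k, rfl⟩ := Nat.exists_eq_add_of_le' hk1
      obtain ⟨i, rfl⟩ := Nat.exists_eq_add_of_le' hi1
      have hlt : k * p + i < n * p := by
        have := Nat.mul_le_mul_right p hkn
        rw [add_mul] at this
        omega
      rw [show (k + 1) * p + (i + 1) - 1 = k * p + i + p by rw [add_mul]; omega,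
        show (k + 1) * p + (i + 1) = k * p + i + p + 1 by rw [add_mul]; omega,
        colM1_shift_mem_iff hp h hspan hlt] at hmem
      rw [show (k + 1 - 1) * p + (i + 1) - 1 = k * p + i by simp,
        show (k + 1 - 1) * p + (i + 1) = k * p + i + 1 by simp [add_assoc],
        colM1_notMem_iff hp h hspan (by rw [add_mul]; omega)] at hnot
      refine ⟨k * p + i, ⟨⟨by omega, hlt⟩, hnot, hmem⟩, ?_⟩
      rw [mul_comm, Nat.mul_add_mod, Nat.mod_eq_of_lt (by omega)]
    · rintro ⟨j, ⟨⟨-, hj⟩, hnot, hmem⟩, rfl⟩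
      have hmod := Nat.mod_lt j hp
      have hdiv := Nat.div_add_mod' j p
      refine ⟨⟨by omega, by omega⟩, j / p + 1, ⟨Nat.le_add_left _ _,
        Nat.div_lt_of_lt_mul (by rwa [mul_comm])⟩, ?_, ?_⟩
      · rw [show (j / p + 1) * p + (j % p + 1) - 1 = j + p by rw [add_mul]; omega,
          show (j / p + 1) * p + (j % p + 1) = j + p + 1 by rw [add_mul]; omega,
          colM1_shift_mem_iff hp h hspan hj]
        exact hmem
      · rw [show (j / p + 1 - 1) * p + (j % p + 1) - 1 = j by simp; omega,
          show (j / p + 1 - 1) * p + (j % p + 1) = j + 1 by simp; omega,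
          colM1_notMem_iff hp h hspan (by rw [add_mul]; omega)]
        exact hnot
  · have key : ∀ a b, a < b → a % p = b % p →
        Y (krylovSeq hp Y e a) ∈ (initialSpan (krylovSeq hp Y e) a).map Y →
        krylovSeq hp Y e b ∈ initialSpan (krylovSeq hp Y e) b := by
      intro a b hab hmod hmem
      obtain ⟨c, hc⟩ := (Nat.modEq_iff_dvd' hab.le).1 hmod
      obtain ⟨l, rfl⟩ : ∃ l, c = l + 1 := by
        refine Nat.exists_eq_add_of_le' (Nat.one_le_iff_ne_zero.2 ?_)
        rintro rfl
        omega
      have h1 := krylovSeq_add_mul_mem hp hmem l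
      rwa [mul_comm (l + 1) p, ← hc, Nat.add_sub_of_le hab.le] at h1
    intro a ha b hb hab
    simp only [Finset.coe_filter, Set.mem_ofPred_eq] at ha hb
    simp only [Nat.add_right_cancel_iff] at hab
    rcases lt_trichotomy a b with hlt | heq | hlt
    · exact absurd (key a b hlt hab ha.2.2) hb.2.1
    · exact heq
    · exact absurd (key b a hlt hab.symm hb.2.2) ha.2.1

open Classical in
theorem ncard_setB_add [FiniteDimensional ℝ E] (hp : 0 < p) (h : IsOperatorModel n T Y e)
    (hspan : krylov (n + 1) Y e = ⊤) :
    (setB n p hp T).ncard + finrank ℝ (LinearMap.range (krylovTest n Y e ∘ₗ Y)) +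
        finrank ℝ (krylov n Y e) =
      finrank ℝ E + finrank ℝ ((krylov n Y e).map (krylovTest n Y e ∘ₗ Y)) := by
  have hcount := card_jump_add (krylovSeq hp Y e) (krylovTest n Y e ∘ₗ Y)
    (Nat.mul_le_mul_right p (Nat.le_succ n))
  rw [initialSpan_krylovSeq, Nat.succ_eq_add_one, initialSpan_krylovSeq, hspan, finrank_top,
    Submodule.map_top] at hcount
  rw [← hcount]
  congr 2
  rw [← Finset.card_image_of_injOn (f := fun j => j - n * p + 1), ← Set.ncard_coe_finset]
  · congr 1
    ext i
    simp only [setB, Set.mem_ofPred_eq, Finset.coe_image, Finset.coe_filter, Finset.mem_Ico,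
      Set.mem_image, Set.mem_Icc]
    constructor
    · rintro ⟨⟨hi1, hip⟩, hmem, hnot⟩
      obtain ⟨i, rfl⟩ := Nat.exists_eq_add_of_le' hi1
      have hlt : n * p + i < (n + 1) * p := by rw [add_mul]; omega
      rw [show (n + 1) * p + (i + 1) - 1 = n * p + i + p by rw [add_mul]; omega,
        show (n + 1) * p + (i + 1) = n * p + i + p + 1 by rw [add_mul]; omega,
        colM2_shift_mem_iff hp h hlt] at hmem
      exact ⟨n * p + i, ⟨⟨by omega, hlt⟩, (colM1_notMem_iff hp h hspan hlt).1 hnot, hmem⟩,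
        by omega⟩
    · rintro ⟨j, ⟨⟨hj1, hj2⟩, hnot, hmem⟩, rfl⟩
      have hlt := hj2
      rw [add_mul, one_mul] at hj2
      obtain ⟨i, rfl⟩ := Nat.exists_eq_add_of_le hj1
      rw [Nat.add_sub_cancel_left]
      refine ⟨⟨by omega, by omega⟩, ?_, ?_⟩
      · rw [show (n + 1) * p + (i + 1) - 1 = n * p + i + p by rw [add_mul]; omega,
          show (n + 1) * p + (i + 1) = n * p + i + p + 1 by rw [add_mul]; omega,
          colM2_shift_mem_iff hp h hlt]
        exact hmem
      · exact (colM1_notMem_iff hp h hspan hlt).2 hnot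
  · intro a ha b hb hab
    simp only [Finset.coe_filter, Finset.mem_Ico, Set.mem_ofPred_eq] at ha hb
    simp only at hab
    omega

theorem disjoint_setA_setB (hp : 0 < p) (h : IsOperatorModel n T Y e)
    (hspan : krylov (n + 1) Y e = ⊤) : Disjoint (setA n p hp T) (setB n p hp T) := by
  rw [Set.disjoint_left]
  rintro i ⟨⟨hi1, hip⟩, k, ⟨hk1, hkn⟩, hmem, -⟩ ⟨-, -, hnot⟩
  obtain ⟨k, rfl⟩ := Nat.exists_eq_add_of_le' hk1
  obtain ⟨i, rfl⟩ := Nat.exists_eq_add_of_le' hi1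
  obtain ⟨l, rfl⟩ := Nat.exists_eq_add_of_le hkn
  rw [show (k + 1) * p + (i + 1) - 1 = k * p + i + p by rw [add_mul]; omega,
    show (k + 1) * p + (i + 1) = k * p + i + p + 1 by rw [add_mul]; omega,
    colM1_shift_mem_iff hp h hspan (by rw [add_mul, add_mul]; omega)] at hmem
  refine (colM1_notMem_iff hp h hspan (by rw [add_mul _ 1]; omega)).1 hnot ?_
  rw [Nat.add_succ_sub_one]
  convert krylovSeq_add_mul_mem hp hmem l using 2 <;> ring

/-- The kernel dimensions of the symmetric extensions compatible with the moments. -/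
theorem exists_extension_iff_ncard [FiniteDimensional ℝ E] (hp : 0 < p)
    (h : IsOperatorModel n T Y e) (hspan : krylov (n + 1) Y e = ⊤) (m : ℕ) :
    (∃ Z : E →ₗ[ℝ] E, Z.IsSymmetric ∧ (∀ d ∈ krylov n Y e, Z d = Y d) ∧
      finrank ℝ (LinearMap.ker Z) = m) ↔
    (setA n p hp T).ncard ≤ m ∧ m ≤ (setA n p hp T ∪ setB n p hp T).ncard := by
  have hfinA : (setA n p hp T).Finite := (Set.finite_Icc 1 p).subset fun _ hi => hi.1
  have hfinB : (setB n p hp T).Finite := (Set.finite_Icc 1 p).subset fun _ hi => hi.1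
  rw [exists_extension_finrank_ker_iff h.1 (ker_krylovTest n Y e),
    Set.ncard_union_eq (disjoint_setA_setB hp h hspan) hfinA hfinB]
  have hA := ncard_setA_add hp h hspan
  have hB := ncard_setB_add hp h hspan
  omega

end IndexSets

section Shift

open Module

variable {E : Type*} [NormedAddCommGroup E] [InnerProductSpace ℝ E] {n p : ℕ}
  {S : ℕ → Matrix (Fin p) (Fin p) ℝ} {X : E →ₗ[ℝ] E} {e : Fin p → E}

theorem isSymmetric_smul_one (c : ℝ) : (c • (1 : E →ₗ[ℝ] E)).IsSymmetric := by
  intro u v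
  simp [inner_smul_left, inner_smul_right]

theorem IsOperatorModel.shiftT (h : IsOperatorModel n S X e) (t : ℝ) :
    IsOperatorModel n (shiftT p t S) (X - t • 1) e := by
  refine ⟨h.1.sub (isSymmetric_smul_one t), fun k hk i j => ?_⟩
  have hc : Commute ((-t) • (1 : E →ₗ[ℝ] E)) X := (Commute.one_left X).smul_left (-t)
  rw [show X - t • 1 = (-t) • 1 + X by rw [neg_smul]; abel, hc.add_pow, LinearMap.sum_apply,
    inner_sum, _root_.shiftT, Matrix.sum_apply]
  refine Finset.sum_congr rfl fun l hl => ?_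
  rw [Matrix.smul_apply, h.2 _ (by omega), smul_pow, one_pow, smul_mul_assoc, one_mul,
    smul_mul_assoc, LinearMap.smul_apply, inner_smul_right, ← nsmul_eq_mul', LinearMap.smul_apply,
    ← Nat.cast_smul_eq_nsmul ℝ, inner_smul_right, neg_pow t l, smul_eq_mul]
  ring

/-- The shifted moments determine the moments. -/
theorem eq_of_shiftT_eq {S S' : ℕ → Matrix (Fin p) (Fin p) ℝ} {t : ℝ} {N : ℕ}
    (h : ∀ k ≤ N, shiftT p t S k = shiftT p t S' k) : ∀ k ≤ N, S k = S' k := by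
  intro k
  induction k using Nat.strong_induction_on with
  | _ k ih =>
    intro hk
    have h1 := h k hk
    rw [shiftT, shiftT, Finset.sum_range_succ', Finset.sum_range_succ' _ k] at h1
    have h2 : ∀ l ∈ Finset.range k, S (k - (l + 1)) = S' (k - (l + 1)) := fun l hl => by
      rw [Finset.mem_range] at hl
      exact ih _ (by omega) (by omega)
    rw [Finset.sum_congr rfl fun l hl => by rw [h2 l hl]] at h1
    simpa using h1

theorem IsOperatorModel.of_shiftT {t : ℝ} (h : IsOperatorModel n (_root_.shiftT p t S) X e) :
    IsOperatorModel n S (X + t • 1) e := by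
  have hsym : (X + t • 1).IsSymmetric := h.1.add (isSymmetric_smul_one t)
  let S' : ℕ → Matrix (Fin p) (Fin p) ℝ := fun k i j => inner ℝ (e i) (((X + t • 1) ^ k) (e j))
  have h' : IsOperatorModel n S' (X + t • 1) e := ⟨hsym, fun _ _ _ _ => rfl⟩
  have h1 := h'.shiftT t
  rw [add_sub_cancel_right] at h1
  refine ⟨hsym, fun k hk i j => ?_⟩
  have hS : S k = S' k := eq_of_shiftT_eq (t := t) (fun k hk => by
    ext i j
    rw [h.2 k hk, h1.2 k hk]) k hk
  exact congrFun (congrFun hS i) j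

theorem krylov_add_smul_one_le (N : ℕ) (X : E →ₗ[ℝ] E) (e : Fin p → E) (c : ℝ) :
    krylov N (X + c • 1) e ≤ krylov N X e := by
  rw [krylov, Submodule.span_le]
  rintro _ ⟨⟨k, i⟩, rfl⟩
  have hc : Commute (c • (1 : E →ₗ[ℝ] E)) X := (Commute.one_left X).smul_left c
  simp only [SetLike.mem_coe]
  rw [add_comm X, hc.add_pow, LinearMap.sum_apply]
  refine Submodule.sum_mem _ fun l hl => ?_
  rw [smul_pow, one_pow, smul_mul_assoc, one_mul, smul_mul_assoc, LinearMap.smul_apply,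
    ← nsmul_eq_mul', LinearMap.smul_apply]
  exact Submodule.smul_mem _ _ (Submodule.smul_of_tower_mem _ _ (mem_krylov (by omega) i))

theorem krylov_add_smul_one_eq_top {N : ℕ} {X : E →ₗ[ℝ] E} {e : Fin p → E}
    (h : krylov N X e = ⊤) (c : ℝ) : krylov N (X + c • 1) e = ⊤ := by
  have h1 := krylov_add_smul_one_le N (X + c • 1) e (-c)
  rw [neg_smul, add_neg_cancel_right, h] at h1
  exact top_le_iff.1 h1

theorem krylov_sub_smul_one_eq_top {N : ℕ} {X : E →ₗ[ℝ] E} {e : Fin p → E}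
    (h : krylov N X e = ⊤) (c : ℝ) : krylov N (X - c • 1) e = ⊤ := by
  rw [sub_eq_add_neg, ← neg_smul]
  exact krylov_add_smul_one_eq_top h (-c)

theorem rank_momentMatrix [FiniteDimensional ℝ E] (h : IsOperatorModel n S X e) :
    (momentMatrix n p S).rank = finrank ℝ (krylov (n + 1) X e) := by
  have hcol : Set.range (momentMatrix n p S).col = krylovTest (n + 1) X e ''
      Set.range fun q : Fin (n + 1) × Fin p => (X ^ q.1.1) (e q.2) := by
    rw [← Set.range_comp]
    congr 1
    ext q r
    rw [Function.comp_apply, krylovTest_apply, h.inner_pow_pow (by omega)]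
    rfl
  rw [Matrix.rank_eq_finrank_span_cols, hcol, ← Submodule.map_span, ← krylov,
    ← finrank_map_add_finrank_inf_ker (krylovTest (n + 1) X e) (krylov (n + 1) X e),
    ker_krylovTest, Submodule.inf_orthogonal_eq_bot, finrank_bot, add_zero]

/-- Compressing an operator model to `krylov (n + 1) X e` preserves the moments. -/
theorem IsOperatorModel.exists_compression [FiniteDimensional ℝ E]
    (h : IsOperatorModel n S X e) :
    ∃ (Y : krylov (n + 1) X e →ₗ[ℝ] krylov (n + 1) X e) (e' : Fin p → krylov (n + 1) X e),
      IsOperatorModel n S Y e' ∧ krylov (n + 1) Y e' = ⊤ := by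
  let H := krylov (n + 1) X e
  let Y : H →ₗ[ℝ] H := H.orthogonalProjectionOnto.toLinearMap ∘ₗ X ∘ₗ H.subtype
  let e' : Fin p → H := fun i => ⟨e i, by simpa using mem_krylov (X := X) (Nat.succ_pos n) i⟩
  have hY : Y.IsSymmetric := by
    intro u v
    simp only [Y, LinearMap.comp_apply, ContinuousLinearMap.coe_coe, Submodule.subtype_apply]
    rw [Submodule.inner_orthogonalProjectionOnto_eq_of_mem_right,
      Submodule.inner_orthogonalProjectionOnto_eq_of_mem_left]
    exact h.1 _ _
  have hpow : ∀ k ≤ n, ∀ i, (((Y ^ k) (e' i) : H) : E) = (X ^ k) (e i) := by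
    intro k
    induction k with
    | zero => simp [e']
    | succ k ih =>
      intro hk i
      have hmem : X ((X ^ k) (e i)) ∈ H := by
        rw [← Module.End.mul_apply, ← pow_succ']
        exact mem_krylov (by omega) i
      rw [pow_succ', Module.End.mul_apply, pow_succ', Module.End.mul_apply]
      simp only [Y, LinearMap.comp_apply, ContinuousLinearMap.coe_coe, Submodule.subtype_apply]
      rw [ih (by omega), Submodule.coe_orthogonalProjectionOnto_apply,
        Submodule.starProjection_eq_self_iff.2 hmem]
  refine ⟨Y, e', ⟨hY, fun k hk i j => ?_⟩, ?_⟩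
  · obtain ⟨a, b, ha, hb, rfl⟩ : ∃ a b, a ≤ n ∧ b ≤ n ∧ k = a + b :=
      ⟨k / 2, k - k / 2, by omega, by omega, by omega⟩
    rw [pow_add, Module.End.mul_apply, ← hY.pow a, Submodule.coe_inner, hpow a ha, hpow b hb,
      h.inner_pow_pow hk]
  · have hmap : (krylov (n + 1) Y e').map H.subtype = H := by
      rw [krylov, Submodule.map_span, ← Set.range_comp]
      change _ = krylov (n + 1) X e
      rw [krylov]
      congr 2
      ext q
      exact hpow _ (by omega) _
    apply Submodule.map_injective_of_injective H.injective_subtype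
    rw [hmap, Submodule.map_subtype_top]

end Shift

section Measures

open Module

theorem finrank_ker_sub_smul_one {ι E : Type*} [Fintype ι] [AddCommGroup E] [Module ℝ E]
    (b : Basis ι ℝ E) {X : E →ₗ[ℝ] E} {d : ι → ℝ} (hX : ∀ i, X (b i) = d i • b i) (t : ℝ) :
    finrank ℝ (LinearMap.ker (X - t • 1)) = Fintype.card {i // d i = t} := by
  have hrepr : ∀ u i, b.repr (X u) i = d i * b.repr u i := by
    intro u i
    have h : b.coord i ∘ₗ X = d i • b.coord i := by
      refine b.ext fun j => ?_
      by_cases hij : j = i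
      · subst hij
        simp [hX]
      · simp [hX, Finsupp.single_eq_of_ne' hij]
    exact LinearMap.congr_fun h u
  have hker : LinearMap.ker (X - t • 1) =
      Submodule.span ℝ (Set.range fun i : {i // d i = t} => b i) := by
    ext u
    rw [show (Set.range fun i : {i // d i = t} => b i) = b '' {i | d i = t} by
      rw [Set.image_eq_range]; rfl, b.mem_span_image, LinearMap.mem_ker, b.ext_elem_iff]
    simp only [LinearMap.sub_apply, LinearMap.smul_apply, Module.End.one_apply, map_sub, map_smul,
      Finsupp.sub_apply, hrepr, Finsupp.smul_apply, map_zero, Finsupp.zero_apply, smul_eq_mul,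
      Set.subset_def, Finset.mem_coe, Finsupp.mem_support_iff, Set.mem_ofPred_eq, ← sub_mul,
      mul_eq_zero, sub_eq_zero]
    exact forall_congr' fun i => or_iff_not_imp_right
  rw [hker]
  exact finrank_span_eq_card (b.linearIndependent.comp _ Subtype.val_injective)

/-- Multiplication by a function on a finite index set. -/
noncomputable def diagonalOperator {ι : Type*} (d : ι → ℝ) :
    EuclideanSpace ℝ ι →ₗ[ℝ] EuclideanSpace ℝ ι where
  toFun u := WithLp.toLp 2 fun i => d i * u i
  map_add' u v := by
    ext i
    simp [mul_add]
  map_smul' c u := by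
    ext i
    simp [mul_left_comm]

theorem diagonalOperator_apply {ι : Type*} (d : ι → ℝ) (u : EuclideanSpace ℝ ι) (i : ι) :
    diagonalOperator d u i = d i * u i := rfl

theorem diagonalOperator_isSymmetric {ι : Type*} [Fintype ι] (d : ι → ℝ) :
    (diagonalOperator d).IsSymmetric := by
  intro u v
  simp only [PiLp.inner_apply, diagonalOperator_apply, RCLike.inner_apply, conj_trivial]
  exact Finset.sum_congr rfl fun i _ => by ring

theorem diagonalOperator_pow_apply {ι : Type*} (d : ι → ℝ) (k : ℕ) (u : EuclideanSpace ℝ ι)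
    (i : ι) : (diagonalOperator d ^ k) u i = d i ^ k * u i := by
  induction k with
  | zero => simp
  | succ k ih => rw [pow_succ', Module.End.mul_apply, diagonalOperator_apply, ih]; ring

theorem posSemidef_apply_eq_sum {p : ℕ} {A : Matrix (Fin p) (Fin p) ℝ} (hA : A.PosSemidef)
    (a b : Fin p) :
    A a b = ∑ i : {i // hA.1.eigenvalues i ≠ 0},
      (√(hA.1.eigenvalues i) * hA.1.eigenvectorBasis i a) *
        (√(hA.1.eigenvalues i) * hA.1.eigenvectorBasis i b) := by
  have h1 : A a b = ∑ i, hA.1.eigenvalues i *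
      (hA.1.eigenvectorBasis i a * hA.1.eigenvectorBasis i b) := by
    conv_lhs => rw [hA.1.spectral_theorem]
    rw [Unitary.conjStarAlgAut_apply, Matrix.mul_apply]
    refine Finset.sum_congr rfl fun i _ => ?_
    simp only [Matrix.mul_diagonal, Matrix.IsHermitian.eigenvectorUnitary_apply,
      Matrix.star_apply, Function.comp_apply, RCLike.ofReal_real_eq_id, id_eq, star_trivial]
    ring
  rw [h1, ← Finset.sum_filter_of_ne (p := fun i => hA.1.eigenvalues i ≠ 0)
    (fun i _ hi => left_ne_zero_of_mul hi),
    Finset.sum_subtype (p := fun i => hA.1.eigenvalues i ≠ 0) _ (by simp)]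
  refine Finset.sum_congr rfl fun i _ => ?_
  rw [mul_mul_mul_comm, Real.mul_self_sqrt (hA.eigenvalues_nonneg i)]

variable {n p : ℕ} {S : ℕ → Matrix (Fin p) (Fin p) ℝ}

/-- A matrix measure is realized by a multiplication operator on a space whose dimension is the
sum of the ranks of the masses. -/
theorem exists_operatorModel_of_moments {ℓ : ℕ} {x : Fin ℓ → ℝ}
    {A : Fin ℓ → Matrix (Fin p) (Fin p) ℝ} (hA : ∀ j, (A j).PosSemidef)
    (hS : ∀ i, i ≤ 2 * n → S i = ∑ j, x j ^ i • A j) :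
    ∃ (r : Fin ℓ → Type) (_ : ∀ j, Fintype (r j))
      (e : Fin p → EuclideanSpace ℝ (Σ j, r j)),
      (∀ j, Fintype.card (r j) = (A j).rank) ∧
      IsOperatorModel n S (diagonalOperator fun q : Σ j, r j => x q.1) e := by
  classical
  refine ⟨fun j => {i // (hA j).1.eigenvalues i ≠ 0}, fun j => inferInstance,
    fun a => WithLp.toLp 2 fun q =>
      √((hA q.1).1.eigenvalues q.2) * (hA q.1).1.eigenvectorBasis q.2 a,
    fun j => ((hA j).1.rank_eq_card_non_zero_eigs).symm, diagonalOperator_isSymmetric _,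
    fun k hk a b => ?_⟩
  rw [hS k hk, Matrix.sum_apply, PiLp.inner_apply, Fintype.sum_sigma]
  refine Finset.sum_congr rfl fun j _ => ?_
  rw [Matrix.smul_apply, posSemidef_apply_eq_sum (hA j), smul_eq_mul, Finset.mul_sum]
  refine Finset.sum_congr rfl fun i _ => ?_
  rw [diagonalOperator_pow_apply]
  simp only [RCLike.inner_apply, conj_trivial]
  ring

theorem rank_momentMatrix_le_sum_rank {ℓ : ℕ} {x : Fin ℓ → ℝ}
    {A : Fin ℓ → Matrix (Fin p) (Fin p) ℝ} (hA : ∀ j, (A j).PosSemidef)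
    (hS : ∀ i, i ≤ 2 * n → S i = ∑ j, x j ^ i • A j) :
    (momentMatrix n p S).rank ≤ ∑ j, (A j).rank := by
  obtain ⟨r, _, e, hr, h⟩ := exists_operatorModel_of_moments hA hS
  rw [rank_momentMatrix h]
  refine (Submodule.finrank_le _).trans_eq ?_
  rw [finrank_euclideanSpace, Fintype.card_sigma]
  exact Finset.sum_congr rfl fun j _ => hr j

/-- A minimal measure with multiplicity `m` at `t` yields an operator model on the span of the
vectors `X ^ k (e i)`, `k ≤ n`, with `dim ker (X - t) = m`. -/
theorem exists_operatorModel_of_isMinimal {ℓ : ℕ} {x : Fin ℓ → ℝ}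
    {A : Fin ℓ → Matrix (Fin p) (Fin p) ℝ} (h : IsRepMeasure n p S ℓ x A)
    (hmin : IsMinimal n p S A) {t : ℝ} {m : ℕ} (hm : MultEq x A t m) :
    ∃ (ι : Type) (_ : Fintype ι) (X : EuclideanSpace ℝ ι →ₗ[ℝ] EuclideanSpace ℝ ι)
      (e : Fin p → EuclideanSpace ℝ ι), IsOperatorModel n S X e ∧ krylov (n + 1) X e = ⊤ ∧
      finrank ℝ (LinearMap.ker (X - t • 1)) = m := by
  classical
  obtain ⟨hinj, hA, -, hS⟩ := h
  obtain ⟨r, _, e, hr, hmod⟩ := exists_operatorModel_of_moments hA hS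
  refine ⟨Σ j, r j, inferInstance, _, e, hmod, ?_, ?_⟩
  · apply Submodule.eq_top_of_finrank_eq
    rw [← rank_momentMatrix hmod, ← hmin, finrank_euclideanSpace, Fintype.card_sigma]
    exact Finset.sum_congr rfl fun j _ => (hr j).symm
  · rw [finrank_ker_sub_smul_one (EuclideanSpace.basisFun (Σ j, r j) ℝ).toBasis
      (d := fun q => x q.1)]
    · rcases hm with ⟨j, hj, rfl⟩ | ⟨hne, rfl⟩
      · rw [← hr j]
        refine Fintype.card_congr ⟨fun q => cast (by rw [hinj (q.2.trans hj.symm)]) q.1.2,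
          fun i => ⟨⟨j, i⟩, hj⟩, ?_, fun i => rfl⟩
        rintro ⟨⟨j', i⟩, hq⟩
        obtain rfl : j' = j := hinj (hq.trans hj.symm)
        rfl
      · rw [Fintype.card_eq_zero_iff]
        exact ⟨fun q => hne _ q.2⟩
    · intro q
      ext i
      by_cases hi : i = q
      · subst hi
        simp [diagonalOperator_apply]
      · simp [diagonalOperator_apply, hi]

/-- The spectral measure of an operator model generated by the vectors `X ^ k (e i)`, `k ≤ n`,
is a minimal representing measure. -/
theorem exists_isMinimal_of_operatorModel {E : Type*} [NormedAddCommGroup E]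
    [InnerProductSpace ℝ E] [FiniteDimensional ℝ E] {X : E →ₗ[ℝ] E} {e : Fin p → E}
    (h : IsOperatorModel n S X e) (hspan : krylov (n + 1) X e = ⊤) :
    ∃ (ℓ : ℕ) (x : Fin ℓ → ℝ) (A : Fin ℓ → Matrix (Fin p) (Fin p) ℝ),
      IsRepMeasure n p S ℓ x A ∧ IsMinimal n p S A ∧
        ∀ t, MultEq x A t (finrank ℝ (LinearMap.ker (X - t • 1))) := by
  classical
  let b := h.1.eigenvectorBasis rfl
  let d := h.1.eigenvalues rfl
  have hb : ∀ i, X (b i) = d i • b i := h.1.apply_eigenvectorBasis rfl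
  let s : Finset ℝ := Finset.univ.image d
  let x : Fin s.card → ℝ := fun j => s.equivFin.symm j
  have hx : Function.Injective x := Subtype.val_injective.comp s.equivFin.symm.injective
  have hxd : ∀ i, ∃ j, x j = d i := fun i =>
    ⟨s.equivFin ⟨d i, Finset.mem_image_of_mem d (Finset.mem_univ i)⟩, by simp [x]⟩
  have hdx : ∀ j, ∃ i, d i = x j := fun j => by
    obtain ⟨i, -, hi⟩ := Finset.mem_image.1 (s.equivFin.symm j).2
    exact ⟨i, hi⟩
  let C : ∀ j, Matrix {i // d i = x j} (Fin p) ℝ := fun j i a => inner ℝ (b i) (e a)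
  let A : Fin s.card → Matrix (Fin p) (Fin p) ℝ := fun j => (C j)ᴴ * C j
  have hpsd : ∀ j, (A j).PosSemidef := fun j => Matrix.posSemidef_conjTranspose_mul_self _
  have hpow : ∀ k i (u : E), inner ℝ (b i) ((X ^ k) u) = d i ^ k * inner ℝ (b i) u := by
    intro k i u
    induction k with
    | zero => simp
    | succ k ih =>
      rw [pow_succ', Module.End.mul_apply, ← h.1, hb, inner_smul_left, ih, RCLike.conj_to_real]
      ring
  have hfiber : ∀ f : Fin (finrank ℝ E) → ℝ, ∑ i, f i = ∑ j, ∑ i : {i // d i = x j}, f i := by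
    intro f
    choose g hg using hxd
    have hj : ∀ j, ∑ i : {i // d i = x j}, f i = ∑ i, if d i = x j then f i else 0 := fun j => by
      rw [← Finset.sum_filter]
      exact (Finset.sum_subtype _ (by simp) f).symm
    rw [Finset.sum_congr rfl fun j _ => hj j, Finset.sum_comm]
    refine Finset.sum_congr rfl fun i _ => ?_
    simp [← hg i, hx.eq_iff]
  have hS : ∀ k, k ≤ 2 * n → S k = ∑ j, x j ^ k • A j := by
    intro k hk
    ext a c
    rw [h.2 k hk, ← b.sum_inner_mul_inner, hfiber, Matrix.sum_apply]
    refine Finset.sum_congr rfl fun j _ => ?_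
    rw [Matrix.smul_apply, show A j = (C j)ᴴ * C j from rfl, Matrix.mul_apply, smul_eq_mul,
      Finset.mul_sum]
    refine Finset.sum_congr rfl fun i _ => ?_
    rw [hpow, i.2, real_inner_comm]
    rw [Matrix.conjTranspose_apply, star_trivial]
    ring
  have hle : ∀ j ∈ Finset.univ, (A j).rank ≤ Fintype.card {i // d i = x j} := fun j _ =>
    (Matrix.rank_mul_le_right _ _).trans (Matrix.rank_le_card_height _)
  have hcard : ∑ j, Fintype.card {i // d i = x j} = finrank ℝ E := by
    have h1 := hfiber fun _ => 1
    simp only [Finset.sum_const, Finset.card_univ, Fintype.card_fin, nsmul_eq_mul, mul_one] at h1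
    exact_mod_cast h1.symm
  have hrankM : (momentMatrix n p S).rank = finrank ℝ E := by
    rw [rank_momentMatrix h, hspan, finrank_top]
  have hsum : ∑ j, (A j).rank = ∑ j, Fintype.card {i // d i = x j} :=
    le_antisymm (Finset.sum_le_sum hle)
      ((hcard.trans hrankM.symm).trans_le (rank_momentMatrix_le_sum_rank hpsd hS))
  have hrank : ∀ j, (A j).rank = Fintype.card {i // d i = x j} := fun j =>
    (Finset.sum_eq_sum_iff_of_le hle).1 hsum j (Finset.mem_univ j)
  refine ⟨s.card, x, A, ⟨hx, hpsd, fun j hj => ?_, hS⟩, ?_, fun t => ?_⟩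
  · obtain ⟨i, hi⟩ := hdx j
    have h1 := hrank j
    rw [hj, Matrix.rank_zero] at h1
    exact (Fintype.card_eq_zero_iff.1 h1.symm).false ⟨i, hi⟩
  · rw [IsMinimal, hsum, hcard, hrankM]
  · rw [finrank_ker_sub_smul_one b.toBasis (d := d) (by simpa using hb)]
    by_cases ht : ∃ j, x j = t
    · obtain ⟨j, rfl⟩ := ht
      exact Or.inl ⟨j, rfl, hrank j⟩
    · push Not at ht
      refine Or.inr ⟨ht, Fintype.card_eq_zero_iff.2 ⟨fun i => ?_⟩⟩
      obtain ⟨j, hj⟩ := hxd i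
      exact ht j (hj.trans i.2)

end Measures

/-- **Theorem 1.1** (main theorem): a linear operator admitting a representing measure has a
minimal representing measure with multiplicity `m` at `t` iff `#A ≤ m ≤ #(A ∪ B)`. -/
theorem main_theorem (n p : ℕ) (hn : 1 ≤ n) (hp : 0 < p)
    (S : ℕ → Matrix (Fin p) (Fin p) ℝ) (hsymm : ∀ i, i ≤ 2 * n → (S i).IsSymm)
    (hrep : ∃ ℓ x A, IsRepMeasure n p S ℓ x A)
    (t : ℝ) (m : ℕ) :
    (∃ (ℓ : ℕ) (x : Fin ℓ → ℝ) (A : Fin ℓ → Matrix (Fin p) (Fin p) ℝ),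
        IsRepMeasure n p S ℓ x A ∧ IsMinimal n p S A ∧ MultEq x A t m) ↔
      (setA n p hp (shiftT p t S)).ncard ≤ m ∧
        m ≤ (setA n p hp (shiftT p t S) ∪ setB n p hp (shiftT p t S)).ncard := by
  constructor
  · rintro ⟨ℓ, x, A, hμ, hmin, hm⟩
    obtain ⟨ι, _, X, e, hX, hspan, hker⟩ := exists_operatorModel_of_isMinimal hμ hmin hm
    have hspan' : krylov (n + 1) (X - t • 1) e = ⊤ :=
      krylov_sub_smul_one_eq_top hspan t
    exact (exists_extension_iff_ncard hp (hX.shiftT t) hspan' m).1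
      ⟨_, (hX.shiftT t).1, fun _ _ => rfl, hker⟩
  · intro hm
    obtain ⟨ℓ, x, A, -, hA, -, hS⟩ := hrep
    obtain ⟨r, _, e₀, -, h₀⟩ := exists_operatorModel_of_moments hA hS
    obtain ⟨X, e, hX, hspan⟩ := h₀.exists_compression
    have hspan' : krylov (n + 1) (X - t • 1) e = ⊤ :=
      krylov_sub_smul_one_eq_top hspan t
    obtain ⟨Z, hZ, hZX, hker⟩ := (exists_extension_iff_ncard hp (hX.shiftT t) hspan' m).2 hm
    obtain ⟨hZmod, hZspan⟩ := (hX.shiftT t).of_eqOn hZ hZX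
    obtain ⟨ℓ, x, A, hμ, hmin, hmult⟩ := exists_isMinimal_of_operatorModel hZmod.of_shiftT
      (krylov_add_smul_one_eq_top (hZspan.trans hspan') t)
    refine ⟨ℓ, x, A, hμ, hmin, ?_⟩
    have h1 := hmult t
    rwa [add_sub_cancel_right, hker] at h1
end

section
/- Let n ≥ 1, p ≥ 1, let 𝒮 = (S_0,…,S_{2n}) in 𝕊_p(ℝ) admit a representing measure, fix t ∈ ℝ and m ∈ ℕ∪{0} with Card A ≤ m ≤ Card(A∪B), and write B = {i_1,…,i_{Card B}} and {j_1,…,j_{p−Card B}} = {1,…,p}∖B. Then the minimal representing measure μ for 𝒮 with mult_μ t = m is unique if and only if all of the following hold: (i) B = { i ∈ {1,…,p} : y_{np+i} ∉ span{y_1,…,y_{np+i−1}} }; (ii) m = Card(A∪B); (iii) Ker (T_{i+j−2})_{1≤i≤n, 2≤j≤n+1} ⊆ Ker of the matrix whose rows are u_{(n+1)p+i_1}ᵀ, …, u_{(n+1)p+i_{Card B}}ᵀ; (iv) Ker (T_{i+j−2})_{1≤i≤n, 2≤j≤n+1} ⊆ Ker of the matrix whose rows are u_{(n+1)p+j_1}ᵀ,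 …, u_{(n+1)p+j_{p−Card B}}ᵀ. -/
open Finset Matrix

/-- The mass of the (finitely atomic) measure given by atoms `x` and masses `A` at a
point `s ∈ ℝ`; two finitely atomic measures coincide iff their mass functions coincide. -/
noncomputable def massAt {p ℓ : ℕ} (x : Fin ℓ → ℝ)
    (A : Fin ℓ → Matrix (Fin p) (Fin p) ℝ) (s : ℝ) : Matrix (Fin p) (Fin p) ℝ :=
  ∑ j, if x j = s then A j else 0

/-- The localizing matrix `(T_{i+j-2})_{1 ≤ i ≤ n, 2 ≤ j ≤ n+1}` (0-based block entry
`T_{i+j+1}`). -/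
def locM (n p : ℕ) (T : ℕ → Matrix (Fin p) (Fin p) ℝ) :
    Matrix (Fin n × Fin p) (Fin n × Fin p) ℝ :=
  fun ia jb => T (ia.1.1 + jb.1.1 + 1) ia.2 jb.2

/-- The diagonalisation of a real symmetric matrix by an orthogonal matrix. -/
lemma Matrix.IsSymm.exists_orthogonal_diagonal {ι : Type*} [Fintype ι] [DecidableEq ι]
    {X : Matrix ι ι ℝ} (hX : X.IsSymm) :
    ∃ (U : Matrix ι ι ℝ) (d : ι → ℝ), U * Uᵀ = 1 ∧ Uᵀ * U = 1 ∧ X = U * diagonal d * Uᵀ := by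
  have hH : X.IsHermitian := by
    rw [Matrix.IsHermitian, conjTranspose_eq_transpose_of_trivial]; exact hX
  refine ⟨(hH.eigenvectorUnitary : Matrix ι ι ℝ), hH.eigenvalues, ?_, ?_, ?_⟩
  · exact Unitary.coe_mul_star_self hH.eigenvectorUnitary
  · exact Unitary.coe_star_mul_self hH.eigenvectorUnitary
  · have := hH.spectral_theorem
    rw [Unitary.conjStarAlgAut_apply, star_eq_conjTranspose,
      conjTranspose_eq_transpose_of_trivial] at this
    exact this

/-- A positive semidefinite matrix `X` is a Gram matrix of vectors in dimension `rank X`. -/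
lemma Matrix.PosSemidef.exists_eq_transpose_mul_self {ι : Type*} [Fintype ι]
    {X : Matrix ι ι ℝ} (hX : X.PosSemidef) :
    ∃ V : Matrix (Fin X.rank) ι ℝ, X = Vᵀ * V := by
  classical
  have hH := hX.1
  have hcard := hH.rank_eq_card_non_zero_eigs
  let e : Fin X.rank ≃ {i // hH.eigenvalues i ≠ 0} := (Fintype.equivFinOfCardEq hcard.symm).symm
  let u : Matrix ι ι ℝ := hH.eigenvectorUnitary
  refine ⟨Matrix.of fun a b => √(hH.eigenvalues (e a)) * u b (e a), ?_⟩
  ext b c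
  have h1 : X = u * diagonal hH.eigenvalues * uᵀ := by
    have := hH.spectral_theorem
    rw [Unitary.conjStarAlgAut_apply, star_eq_conjTranspose,
      conjTranspose_eq_transpose_of_trivial] at this
    exact this
  have h2 : X b c = ∑ i, u b i * hH.eigenvalues i * u c i := by
    conv_lhs => rw [h1]
    simp only [mul_apply (M := u * diagonal hH.eigenvalues), mul_diagonal, transpose_apply]
  rw [h2, mul_apply]
  simp only [transpose_apply, of_apply]
  rw [Equiv.sum_comp e (fun i => √(hH.eigenvalues i) * u b i * (√(hH.eigenvalues i) * u c i)),
    ← Finset.sum_subtype (p := fun i => hH.eigenvalues i ≠ 0) (Finset.univ.filter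
      fun i => hH.eigenvalues i ≠ 0) (by simp)
      (fun i => √(hH.eigenvalues i) * u b i * (√(hH.eigenvalues i) * u c i)), Finset.sum_filter]
  refine Finset.sum_congr rfl fun i _ => ?_
  split_ifs with hi
  · linear_combination -(u b i * u c i) * Real.mul_self_sqrt (hX.eigenvalues_nonneg i)
  · rw [not_not] at hi
    rw [hi, mul_zero, zero_mul]

/-- The orthogonal projection onto a subspace of `ι → ℝ`, as a symmetric matrix. -/
lemma Submodule.exists_symm_projection {ι : Type*} [Fintype ι] [DecidableEq ι]
    (G : Submodule ℝ (ι → ℝ)) :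
    ∃ P : Matrix ι ι ℝ, P.IsSymm ∧ (∀ g, P *ᵥ g ∈ G) ∧ ∀ g ∈ G, P *ᵥ g = g := by
  let e := WithLp.linearEquiv 2 ℝ (ι → ℝ)
  let K : Submodule ℝ (EuclideanSpace ℝ ι) := G.comap e.toLinearMap
  let f : (ι → ℝ) →ₗ[ℝ] (ι → ℝ) :=
    e.toLinearMap ∘ₗ K.starProjection.toLinearMap ∘ₗ e.symm.toLinearMap
  have hf : ∀ g, LinearMap.toMatrix' f *ᵥ g = f g := fun g => by
    rw [← Matrix.toLin'_apply, Matrix.toLin'_toMatrix']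
  have hdot : ∀ g g', f g ⬝ᵥ g' = g ⬝ᵥ f g' := by
    intro g g'
    have := Submodule.inner_starProjection_left_eq_right K (e.symm g') (e.symm g)
    simp only [EuclideanSpace.inner_eq_star_dotProduct, star_trivial] at this
    exact this.symm
  refine ⟨LinearMap.toMatrix' f, ?_, ?_, ?_⟩
  · ext a b
    have := hdot (Pi.single a 1) (Pi.single b 1)
    simp only [dotProduct_single, single_dotProduct, one_mul, mul_one] at this
    rw [transpose_apply, LinearMap.toMatrix'_apply, LinearMap.toMatrix'_apply]
    simpa using this
  · intro g
    rw [hf]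
    exact K.starProjection_apply_mem (e.symm g)
  · intro g hg
    rw [hf]
    have : K.starProjection (e.symm g) = e.symm g :=
      Submodule.starProjection_eq_self_iff.2 (by simpa [K] using hg)
    simp [f, this]

/-- The Fredholm alternative for real matrices. -/
lemma Matrix.exists_mulVec_eq_of_forall_ker_transpose {ι κ : Type*} [Fintype ι] [Fintype κ]
    (A : Matrix ι κ ℝ) (b : ι → ℝ) (h : ∀ k, Aᵀ *ᵥ k = 0 → k ⬝ᵥ b = 0) :
    ∃ x, A *ᵥ x = b := by
  classical
  obtain ⟨P, hP, hmem, hid⟩ := (LinearMap.range A.mulVecLin).exists_symm_projection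
  have hPA : ∀ x, P *ᵥ (A *ᵥ x) = A *ᵥ x := fun x => hid _ ⟨x, rfl⟩
  have hort : ∀ x, (b - P *ᵥ b) ⬝ᵥ (A *ᵥ x) = 0 := by
    intro x
    rw [sub_dotProduct, dotProduct_comm (P *ᵥ b), dotProduct_mulVec (A *ᵥ x), ← mulVec_transpose,
      hP.eq, hPA, dotProduct_comm b, sub_self]
  have hk : Aᵀ *ᵥ (b - P *ᵥ b) = 0 := by
    apply dotProduct_eq_zero
    intro x
    rw [mulVec_transpose, ← dotProduct_mulVec, hort]
  have h1 := h _ hk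
  obtain ⟨y, hy⟩ := hmem b
  rw [mulVecLin_apply] at hy
  refine ⟨y, ?_⟩
  have h2 : (b - P *ᵥ b) ⬝ᵥ (b - P *ᵥ b) = 0 := by
    rw [dotProduct_sub, h1, ← hy, hy, ← hy, zero_sub, neg_eq_zero]
    have := hort y
    rwa [← hy] at this
  rw [hy]
  exact (sub_eq_zero.1 (dotProduct_self_eq_zero.1 h2)).symm

/-- Between two nested subspaces there is a subspace of every intermediate dimension. -/
lemma Submodule.exists_between_finrank_eq {V : Type*} [AddCommGroup V] [Module ℝ V]
    [FiniteDimensional ℝ V] {L G : Submodule ℝ V} (hLG : L ≤ G) (d : ℕ)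
    (h1 : Module.finrank ℝ L ≤ d) (h2 : d ≤ Module.finrank ℝ G) :
    ∃ E : Submodule ℝ V, L ≤ E ∧ E ≤ G ∧ Module.finrank ℝ E = d := by
  induction d, h1 using Nat.le_induction with
  | base => exact ⟨L, le_rfl, hLG, rfl⟩
  | succ d hd ih =>
    obtain ⟨E, hLE, hEG, hE⟩ := ih (by omega)
    have hne : ¬ G ≤ E := fun hGE => by
      have := Submodule.finrank_mono hGE
      omega
    obtain ⟨v, hvG, hvE⟩ := SetLike.not_le_iff_exists.1 hne
    refine ⟨E ⊔ Submodule.span ℝ {v}, hLE.trans le_sup_left, sup_le hEG ?_, ?_⟩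
    · rwa [Submodule.span_singleton_le_iff_mem]
    · rw [Submodule.finrank_sup_span_singleton hvE, hE]

/-- Given a symmetric partial block matrix `[[H, h], [hᵀ, ?]]` and a subspace `E` of
`{g | h g ∈ range H}`, there is a line `Z + ε Q` of symmetric completions such that for `ε ≠ 0`
the kernel of the completed matrix projects onto `E`, and such that the completions agree with a
given symmetric completion `Z₀` on the vectors of `E` which `Z₀` lifts to its kernel. -/
lemma Matrix.exists_completion_line {α β : Type*} [Fintype α] [Fintype β]
    [DecidableEq β] (H : Matrix α α ℝ) (hH : H.IsSymm) (h : Matrix α β ℝ) (Z₀ : Matrix β β ℝ)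
    (hZ₀ : Z₀.IsSymm) (E : Submodule ℝ (β → ℝ)) (hE : ∀ g ∈ E, ∃ f, H *ᵥ f + h *ᵥ g = 0) :
    ∃ Z Q : Matrix β β ℝ, Z.IsSymm ∧ Q.IsSymm ∧ (Q = 0 → E = ⊤) ∧ (∀ g ∈ E, Q *ᵥ g = 0) ∧
      (∀ f, ∀ g ∈ E, H *ᵥ f + h *ᵥ g = 0 → hᵀ *ᵥ f + Z₀ *ᵥ g = 0 → hᵀ *ᵥ f + Z *ᵥ g = 0) ∧
      ∀ ε : ℝ, ε ≠ 0 → ∀ g,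
        (∃ f, H *ᵥ f + h *ᵥ g = 0 ∧ hᵀ *ᵥ f + (Z + ε • Q) *ᵥ g = 0) ↔ g ∈ E := by
  classical
  let G : Submodule ℝ (β → ℝ) := (LinearMap.range H.mulVecLin).comap h.mulVecLin
  have memG : ∀ g, g ∈ G ↔ ∃ f, H *ᵥ f = h *ᵥ g := fun g => Iff.rfl
  have memG' : ∀ g f, H *ᵥ f + h *ᵥ g = 0 → g ∈ G := fun g f hf =>
    (memG g).2 ⟨-f, by rw [mulVec_neg]; exact (eq_neg_of_add_eq_zero_right hf).symm⟩
  have hEG : E ≤ G := fun g hg => by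
    obtain ⟨f, hf⟩ := hE g hg
    exact memG' g f hf
  obtain ⟨P, hP, hPmem, hPid⟩ := G.exists_symm_projection
  obtain ⟨R, hR, hRmem, hRid⟩ := E.exists_symm_projection
  have hC : ∃ C : Matrix α β ℝ, H * C = h * P := by
    choose c hc using fun b => (memG (P *ᵥ Pi.single b 1)).1 (hPmem _)
    refine ⟨(Matrix.of c)ᵀ, ?_⟩
    ext a b
    have := congrFun (hc b) a
    rw [mulVec_mulVec, mulVec_single_one] at this
    rw [← col_apply (h * P), ← this]
    rfl
  obtain ⟨C, hC⟩ := hC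
  have hCT : Cᵀ * H = P * hᵀ := by
    have := congrArg transpose hC
    rwa [transpose_mul, transpose_mul, hH.eq, hP.eq] at this
  have hCG : ∀ g ∈ G, H *ᵥ (C *ᵥ g) = h *ᵥ g := fun g hg => by
    rw [mulVec_mulVec, hC, ← mulVec_mulVec, hPid g hg]
  have hCf : ∀ f, Cᵀ *ᵥ (H *ᵥ f) = P *ᵥ (hᵀ *ᵥ f) := fun f => by
    rw [mulVec_mulVec, hCT, ← mulVec_mulVec]
  let Z : Matrix β β ℝ := Z₀ - P * Z₀ * P + Cᵀ * H * C
  have hZg : ∀ g ∈ G, Z *ᵥ g = Z₀ *ᵥ g - P *ᵥ (Z₀ *ᵥ g) + P *ᵥ (hᵀ *ᵥ (C *ᵥ g)) := by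
    intro g hg
    simp only [Z, add_mulVec, sub_mulVec, ← mulVec_mulVec, hPid g hg, hCf]
  have hQg : ∀ g, (1 - R) *ᵥ g = g - R *ᵥ g := fun g => by rw [sub_mulVec, one_mulVec]
  have hQE : ∀ g ∈ E, (1 - R) *ᵥ g = 0 := fun g hg => by rw [hQg, hRid g hg, sub_self]
  have hPd : ∀ a b, a ⬝ᵥ (P *ᵥ b) = (P *ᵥ a) ⬝ᵥ b := fun a b => by
    rw [dotProduct_mulVec, ← mulVec_transpose, hP.eq]
  refine ⟨Z, 1 - R, ?_, ?_, ?_, hQE, ?_, ?_⟩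
  · simp only [Z, IsSymm, transpose_add, transpose_sub, transpose_mul, transpose_transpose, hH.eq,
      hP.eq, hZ₀.eq, Matrix.mul_assoc]
  · simp only [IsSymm, transpose_sub, transpose_one, hR.eq]
  · intro hQ
    rw [eq_top_iff]
    intro g _
    have h1 := hQg g
    rw [hQ, zero_mulVec] at h1
    rw [sub_eq_zero.1 h1.symm]
    exact hRmem g
  · intro f g hg h1 h2
    have hgG := hEG hg
    have h3 : P *ᵥ (hᵀ *ᵥ (C *ᵥ g)) = P *ᵥ (Z₀ *ᵥ g) := by
      rw [← hCf, hCG g hgG, eq_neg_of_add_eq_zero_right h1, mulVec_neg, hCf,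
        eq_neg_of_add_eq_zero_right h2, mulVec_neg]
    rw [hZg g hgG, h3, sub_add_cancel, h2]
  · intro ε hε g
    constructor
    · rintro ⟨f, h1, h2⟩
      have hg := memG' g f h1
      have h3 : P *ᵥ (hᵀ *ᵥ f) = - P *ᵥ (hᵀ *ᵥ (C *ᵥ g)) := by
        rw [← hCf, eq_neg_of_add_eq_zero_left h1, ← hCG g hg, mulVec_neg, hCf, neg_mulVec]
      have h4 : P *ᵥ ((1 - R) *ᵥ g) = 0 := by
        have := congrArg (P *ᵥ ·) h2
        simp only [add_mulVec, hZg g hg, mulVec_add, mulVec_sub, h3, hPid _ (hPmem _),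
          mulVec_zero, smul_mulVec, mulVec_smul] at this
        rw [neg_mulVec, sub_self, zero_add, neg_add_cancel_left] at this
        exact (smul_eq_zero.1 this).resolve_left hε
      have h5 : P *ᵥ ((1 - R) *ᵥ g) = (1 - R) *ᵥ g := by
        apply hPid
        rw [hQg]
        exact G.sub_mem hg (hEG (hRmem g))
      rw [h5, hQg, sub_eq_zero] at h4
      rw [h4]
      exact hRmem g
    · intro hg
      have hgG := hEG hg
      let w : β → ℝ := hᵀ *ᵥ (C *ᵥ g) - Z₀ *ᵥ g
      have hk : ∃ k, Matrix.fromRows H hᵀ *ᵥ k = Sum.elim (0 : α → ℝ) (w - P *ᵥ w) := by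
        apply exists_mulVec_eq_of_forall_ker_transpose
        intro k hk
        obtain ⟨a, b, rfl⟩ : ∃ a b, k = Sum.elim a b := ⟨k ∘ Sum.inl, k ∘ Sum.inr, by simp⟩
        rw [transpose_fromRows, fromCols_mulVec_sumElim, hH.eq, transpose_transpose] at hk
        have hb := memG' b a hk
        rw [sumElim_dotProduct_sumElim, dotProduct_zero, zero_add, dotProduct_sub, hPd,
          hPid b hb, sub_self]
      obtain ⟨k, hk⟩ := hk
      rw [fromRows_mulVec] at hk
      have hk1 : H *ᵥ k = 0 := funext fun a => congrFun hk (Sum.inl a)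
      have hk2 : hᵀ *ᵥ k = w - P *ᵥ w := funext fun a => congrFun hk (Sum.inr a)
      refine ⟨k - C *ᵥ g, ?_, ?_⟩
      · rw [mulVec_sub, hk1, hCG g hgG, zero_sub, neg_add_cancel]
      · rw [mulVec_sub, hk2, add_mulVec, smul_mulVec, hQE g hg, smul_zero, add_zero, hZg g hgG]
        simp only [w, mulVec_sub]
        abel

/-- `i` is a pivot of the subspace `W` if some vector of `W` has its last nonzero coordinate
at `i`, with respect to the order of the coordinates given by `ord`. -/
def IsPivot {ι : Type*} (ord : ι → ℕ) (W : Submodule ℝ (ι → ℝ)) (i : ι) : Prop :=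
  ∃ w ∈ W, w i = 1 ∧ ∀ k, ord i < ord k → w k = 0

lemma ncard_isPivot {ι : Type*} [Fintype ι] {ord : ι → ℕ} (hord : Function.Injective ord)
    (W : Submodule ℝ (ι → ℝ)) : {i | IsPivot ord W i}.ncard = Module.finrank ℝ W := by
  classical
  have hmax : ∀ s : Finset ι, s.Nonempty → ∃ i ∈ s, ∀ k ∈ s, ord k ≤ ord i := fun s hs =>
    s.exists_max_image ord hs
  rw [← Nat.card_coe_set_eq, Nat.card_eq_fintype_card]
  apply le_antisymm
  · choose w hw using fun i : {i | IsPivot ord W i} => i.2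
    have hli : LinearIndependent ℝ (fun i => (⟨w i, (hw i).1⟩ : W)) := by
      rw [Fintype.linearIndependent_iff]
      intro c hc
      by_contra! hne
      obtain ⟨i₀, hi₀⟩ := hne
      obtain ⟨i, hi, hi'⟩ := (Finset.univ.filter fun i => c i ≠ 0).exists_max_image
        (fun i => ord i) ⟨i₀, by simpa using hi₀⟩
      have h1 := congrFun (congrArg Subtype.val hc) i
      simp only [Submodule.coe_sum, Submodule.coe_smul, Finset.sum_apply, Pi.smul_apply,
        smul_eq_mul, Submodule.coe_zero, Pi.zero_apply] at h1
      rw [Finset.sum_eq_single i] at h1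
      · rw [(hw i).2.1, mul_one] at h1
        exact (Finset.mem_filter.1 hi).2 h1
      · intro b _ hb
        by_cases hcb : c b = 0
        · rw [hcb, zero_mul]
        · have h2 := hi' b (by simpa using hcb)
          have h3 : ord b ≠ ord i := fun h => hb (Subtype.ext (hord h))
          rw [(hw b).2.2 i (by omega), mul_zero]
      · simp
    exact hli.fintype_card_le_finrank
  · let φ : W →ₗ[ℝ] ({i | IsPivot ord W i} → ℝ) :=
      (LinearMap.funLeft ℝ ℝ Subtype.val) ∘ₗ W.subtype
    have hφ : Function.Injective φ := by
      rw [← LinearMap.ker_eq_bot, LinearMap.ker_eq_bot']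
      rintro ⟨w, hw⟩ h0
      by_contra hne
      have hne' : ∃ i, w i ≠ 0 := by
        by_contra! h
        exact hne (Subtype.ext (funext h))
      obtain ⟨i₀, hi₀⟩ := hne'
      obtain ⟨i, hi, hi'⟩ := hmax (Finset.univ.filter fun i => w i ≠ 0) ⟨i₀, by simpa using hi₀⟩
      have hi := (Finset.mem_filter.1 hi).2
      have hpiv : IsPivot ord W i := by
        refine ⟨(w i)⁻¹ • w, W.smul_mem _ hw, by simp [hi], fun k hk => ?_⟩
        have : w k = 0 := by
          by_contra hk0
          have := hi' k (by simpa using hk0)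
          omega
        simp [this]
      exact hi (congrFun h0 ⟨i, hpiv⟩)
    have := LinearMap.finrank_le_finrank_of_injective hφ
    rwa [Module.finrank_fintype_fun_eq_card] at this

lemma isPivot_ker_mulVecLin_iff {ι κ : Type*} [Fintype ι] {ord : ι → ℕ}
    (hord : Function.Injective ord) (A : Matrix κ ι ℝ) (i : ι) :
    IsPivot ord (LinearMap.ker A.mulVecLin) i ↔
      A.col i ∈ Submodule.span ℝ (A.col '' {k | ord k < ord i}) := by
  classical
  constructor
  · rintro ⟨w, hw, hwi, hw0⟩
    rw [LinearMap.mem_ker, mulVecLin_apply, mulVec_eq_sum,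
      ← Finset.add_sum_erase _ _ (Finset.mem_univ i), hwi] at hw
    simp only [MulOpposite.op_one, one_smul] at hw
    change A.col i + _ = 0 at hw
    rw [eq_neg_of_add_eq_zero_left hw]
    refine Submodule.neg_mem _ (Submodule.sum_mem _ fun k hk => ?_)
    rcases lt_trichotomy (ord k) (ord i) with h | h | h
    · rw [op_smul_eq_smul]
      exact Submodule.smul_mem _ _ (Submodule.subset_span ⟨k, h, rfl⟩)
    · exact absurd (hord h) (Finset.ne_of_mem_erase hk)
    · rw [hw0 k h]
      simp
  · intro h
    obtain ⟨c, hc, hsum⟩ := (Finsupp.mem_span_image_iff_linearCombination ℝ).1 h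
    have hc' : ∀ k, ord i ≤ ord k → c k = 0 := fun k hk => by
      by_contra hk0
      have := (Finsupp.mem_supported ℝ c).1 hc (Finsupp.mem_support_iff.2 hk0)
      exact absurd this (by simpa using hk)
    refine ⟨Pi.single i 1 - ⇑c, ?_, ?_, ?_⟩
    · rw [LinearMap.mem_ker, mulVecLin_apply, mulVec_sub, mulVec_single_one, ← hsum,
        Finsupp.linearCombination_apply, Finsupp.sum_fintype _ _ (by simp), mulVec_eq_sum,
        sub_eq_zero]
      simp only [op_smul_eq_smul]
      rfl
    · simp [hc' i le_rfl]
    · intro k hk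
      have : k ≠ i := by rintro rfl; omega
      simp [this, hc' k hk.le]

/-- The `i`-th moment of the matrix measure `∑ r, δ_{ξ r} (v r) (v r)ᵀ`. -/
def vecMoment {R : Type*} [Fintype R] {p : ℕ} (ξ : R → ℝ)
    (v : Matrix R (Fin p) ℝ) (i : ℕ) : Matrix (Fin p) (Fin p) ℝ :=
  fun b c => ∑ r, ξ r ^ i * (v r b * v r c)

/-- The mass at `s` of the matrix measure `∑ r, δ_{ξ r} (v r) (v r)ᵀ`. -/
noncomputable def vecMass {R : Type*} [Fintype R] {p : ℕ} (ξ : R → ℝ)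
    (v : Matrix R (Fin p) ℝ) (s : ℝ) : Matrix (Fin p) (Fin p) ℝ :=
  fun b c => ∑ r, if ξ r = s then v r b * v r c else 0

/-- The matrix of the evaluations `f ↦ ⟪v r, f (ξ r)⟫` on vector polynomials of degree `≤ n`. -/
def evalMat {R : Type*} {p : ℕ} (n : ℕ) (ξ : R → ℝ) (v : Matrix R (Fin p) ℝ) :
    Matrix R (Fin (n + 1) × Fin p) ℝ :=
  fun r kb => ξ r ^ kb.1.1 * v r kb.2

section VecMeasure

variable {R R' : Type*} [Fintype R] [Fintype R'] {n p : ℕ}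

lemma vecMass_eq [DecidableEq R] (ξ : R → ℝ) (v : Matrix R (Fin p) ℝ) (s : ℝ) :
    vecMass ξ v s = vᵀ * diagonal (fun r => if ξ r = s then (1 : ℝ) else 0) * v := by
  ext b c
  rw [mul_apply]
  simp [vecMass, mul_diagonal]

lemma momentMatrix_eq_evalMat {S : ℕ → Matrix (Fin p) (Fin p) ℝ} {ξ : R → ℝ}
    {v : Matrix R (Fin p) ℝ} (hS : ∀ i, i ≤ 2 * n → S i = vecMoment ξ v i) :
    momentMatrix n p S = (evalMat n ξ v)ᵀ * evalMat n ξ v := by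
  ext ⟨i, b⟩ ⟨j, c⟩
  rw [mul_apply, momentMatrix, hS _ (by omega)]
  refine Finset.sum_congr rfl fun r _ => ?_
  simp only [transpose_apply, evalMat]
  ring

lemma locM_eq_evalMat [DecidableEq R] {S : ℕ → Matrix (Fin p) (Fin p) ℝ} {ξ : R → ℝ}
    {v : Matrix R (Fin p) ℝ} (hS : ∀ i, i ≤ 2 * n + 1 → S i = vecMoment ξ v i) :
    locM (n + 1) p S = (evalMat n ξ v)ᵀ * diagonal ξ * evalMat n ξ v := by
  ext ⟨i, b⟩ ⟨j, c⟩
  rw [mul_apply, locM, hS _ (by omega)]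
  refine Finset.sum_congr rfl fun r _ => ?_
  simp only [mul_diagonal, transpose_apply, evalMat]
  ring

lemma exists_right_inverse_of_rank_eq {κ : Type*} [Fintype κ] [DecidableEq R] (Φ : Matrix R κ ℝ)
    (h : Φ.rank = Fintype.card R) : ∃ Ψ : Matrix κ R ℝ, Φ * Ψ = 1 := by
  classical
  rw [← mulVec_surjective_iff_exists_right_inverse]
  have : LinearMap.range Φ.mulVecLin = ⊤ := by
    apply Submodule.eq_top_of_finrank_eq
    rw [Module.finrank_fintype_fun_eq_card, ← h]
    rfl
  exact LinearMap.range_eq_top.1 this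

lemma exists_evalMat_right_inverse [DecidableEq R] {S : ℕ → Matrix (Fin p) (Fin p) ℝ} {ξ : R → ℝ}
    {v : Matrix R (Fin p) ℝ} (hS : ∀ i, i ≤ 2 * n → S i = vecMoment ξ v i)
    (hmin : Fintype.card R = (momentMatrix n p S).rank) :
    ∃ Ψ : Matrix (Fin (n + 1) × Fin p) R ℝ, evalMat n ξ v * Ψ = 1 := by
  apply exists_right_inverse_of_rank_eq
  rw [hmin, momentMatrix_eq_evalMat hS, rank_transpose_mul_self]

lemma rank_transpose_mul_diagonal_mul {κ : Type*} [Fintype κ] [DecidableEq R] [DecidableEq κ]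
    {Φ : Matrix R κ ℝ}
    {Ψ : Matrix κ R ℝ} (h : Φ * Ψ = 1) (ξ : R → ℝ) :
    (Φᵀ * diagonal ξ * Φ).rank + {r | ξ r = 0}.ncard = Fintype.card R := by
  have h1 : (Φᵀ * diagonal ξ * Φ).rank = (diagonal ξ).rank := by
    apply le_antisymm
    · exact (rank_mul_le_left _ _).trans (rank_mul_le_right _ _)
    · have hT : Ψᵀ * Φᵀ = 1 := by rw [← transpose_mul, h, transpose_one]
      have : diagonal ξ = Ψᵀ * (Φᵀ * diagonal ξ * Φ) * Ψ := by
        rw [← Matrix.mul_assoc, ← Matrix.mul_assoc, hT, Matrix.one_mul, Matrix.mul_assoc, h,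
          Matrix.mul_one]
      conv_lhs => rw [this]
      exact (rank_mul_le_left _ _).trans (rank_mul_le_right _ _)
  rw [h1, rank_diagonal, ← Nat.card_coe_set_eq, Nat.card_eq_fintype_card]
  have := Fintype.card_subtype_compl (fun r => ξ r = 0)
  have h2 := Fintype.card_subtype_le (fun r => ξ r = 0)
  simp only [ne_eq, Set.coe_ofPred] at *
  omega

/-- For a minimal measure the multiplicity of `0` is the rank defect between the moment matrix
and the full localizing matrix. -/
lemma rank_locM_add_ncard {S S' : ℕ → Matrix (Fin p) (Fin p) ℝ} {ξ : R → ℝ}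
    {v : Matrix R (Fin p) ℝ} (hS : ∀ i, i ≤ 2 * n → S i = vecMoment ξ v i)
    (hS' : ∀ i, i ≤ 2 * n + 1 → S' i = vecMoment ξ v i)
    (hmin : Fintype.card R = (momentMatrix n p S).rank) :
    (locM (n + 1) p S').rank + {r | ξ r = 0}.ncard = (momentMatrix n p S).rank := by
  classical
  obtain ⟨Ψ, hΨ⟩ := exists_evalMat_right_inverse hS hmin
  rw [locM_eq_evalMat hS', rank_transpose_mul_diagonal_mul hΨ, hmin]

lemma ker_mulVecLin_le_of_moments {S S' : ℕ → Matrix (Fin p) (Fin p) ℝ} {ξ : R → ℝ}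
    {v : Matrix R (Fin p) ℝ} (hS : ∀ i, i ≤ 2 * n → S i = vecMoment ξ v i)
    (hS' : ∀ i, i ≤ 2 * n + 1 → S' i = vecMoment ξ v i) :
    LinearMap.ker (momentMatrix n p S).mulVecLin ≤
      LinearMap.ker (locM (n + 1) p S').mulVecLin := by
  classical
  intro f hf
  rw [LinearMap.mem_ker, mulVecLin_apply] at hf ⊢
  rw [momentMatrix_eq_evalMat hS, ← mulVec_mulVec] at hf
  have h0 : evalMat n ξ v *ᵥ f = 0 := by
    rw [← dotProduct_self_eq_zero, dotProduct_mulVec, ← mulVec_transpose, hf, zero_dotProduct]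
  rw [locM_eq_evalMat hS', ← mulVec_mulVec, h0, mulVec_zero]

/-- A minimal measure is determined by its moments up to order `2n + 1`. -/
lemma vecMass_eq_of_moments_eq {S : ℕ → Matrix (Fin p) (Fin p) ℝ} {ξ : R → ℝ}
    {v : Matrix R (Fin p) ℝ} {ξ' : R' → ℝ} {v' : Matrix R' (Fin p) ℝ}
    (hS : ∀ i, i ≤ 2 * n + 1 → S i = vecMoment ξ v i)
    (hS' : ∀ i, i ≤ 2 * n + 1 → S i = vecMoment ξ' v' i)
    (hmin : Fintype.card R = (momentMatrix n p S).rank)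
    (hmin' : Fintype.card R' = (momentMatrix n p S).rank) :
    vecMass ξ v = vecMass ξ' v' := by
  classical
  obtain ⟨Ψ, hΨ⟩ := exists_evalMat_right_inverse (fun i hi => hS i (by omega)) hmin
  have hM := momentMatrix_eq_evalMat (n := n) (fun i hi => hS i (by omega))
  have hM' := momentMatrix_eq_evalMat (n := n) (fun i hi => hS' i (by omega))
  have hK := locM_eq_evalMat (n := n) hS
  have hK' := locM_eq_evalMat (n := n) hS'
  set Φ := evalMat n ξ v with hΦ
  set Φ' := evalMat n ξ' v' with hΦ'
  rw [hM] at hM'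
  rw [hK] at hK'
  have hT : Ψᵀ * Φᵀ = 1 := by rw [← transpose_mul, hΨ, transpose_one]
  let U : Matrix R' R ℝ := Φ' * Ψ
  have hU : Φ' = U * Φ := by
    have h0 : Φ' * (1 - Ψ * Φ) = 0 := by
      have h1 : Φ'ᵀ * (Φ' * (1 - Ψ * Φ)) = 0 := by
        rw [← Matrix.mul_assoc, ← hM', Matrix.mul_assoc, Matrix.mul_sub, Matrix.mul_one,
          ← Matrix.mul_assoc Φ, hΨ, Matrix.one_mul, sub_self, Matrix.mul_zero]
      have h2 : (Φ' * (1 - Ψ * Φ))ᵀ * (Φ' * (1 - Ψ * Φ)) = 0 := by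
        rw [transpose_mul, Matrix.mul_assoc, h1, Matrix.mul_zero]
      rw [← conjTranspose_eq_transpose_of_trivial] at h2
      exact conjTranspose_mul_self_eq_zero.1 h2
    rw [Matrix.mul_sub, Matrix.mul_one, sub_eq_zero, ← Matrix.mul_assoc] at h0
    exact h0
  have hUU : Uᵀ * U = 1 := by
    simp only [U, transpose_mul]
    rw [Matrix.mul_assoc, ← Matrix.mul_assoc Φ'ᵀ, ← hM', Matrix.mul_assoc, hΨ, Matrix.mul_one, hT]
  have hUU' : U * Uᵀ = 1 := (mul_eq_one_comm_of_card_eq _ _ ℝ (hmin.trans hmin'.symm)).1 hUU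
  have hD : Uᵀ * diagonal ξ' * U = diagonal ξ := by
    simp only [U, transpose_mul]
    calc Ψᵀ * Φ'ᵀ * diagonal ξ' * (Φ' * Ψ) = Ψᵀ * (Φ'ᵀ * diagonal ξ' * Φ') * Ψ := by
          simp only [Matrix.mul_assoc]
      _ = (Ψᵀ * Φᵀ) * diagonal ξ * (Φ * Ψ) := by rw [← hK']; simp only [Matrix.mul_assoc]
      _ = diagonal ξ := by rw [hT, hΨ, Matrix.one_mul, Matrix.mul_one]
  have hDU : diagonal ξ' * U = U * diagonal ξ := by
    calc diagonal ξ' * U = U * Uᵀ * (diagonal ξ' * U) := by rw [hUU', Matrix.one_mul]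
      _ = U * (Uᵀ * diagonal ξ' * U) := by simp only [Matrix.mul_assoc]
      _ = U * diagonal ξ := by rw [hD]
  have hentry : ∀ r' r, U r' r ≠ 0 → ξ' r' = ξ r := by
    intro r' r hne
    have := congrFun (congrFun hDU r') r
    rw [diagonal_mul, mul_diagonal, mul_comm] at this
    exact mul_left_cancel₀ hne this
  have hv : v' = U * v := by
    ext r' b
    have := congrFun (congrFun hU r') ((0 : Fin (n + 1)), b)
    simpa [hΦ, hΦ', evalMat, mul_apply] using this
  funext s
  have hind : diagonal (fun r => if ξ' r = s then (1 : ℝ) else 0) * U =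
      U * diagonal (fun r => if ξ r = s then (1 : ℝ) else 0) := by
    ext r' r
    rw [diagonal_mul, mul_diagonal]
    by_cases hne : U r' r = 0
    · rw [hne, mul_zero, zero_mul]
    · rw [hentry r' r hne, mul_comm]
  rw [vecMass_eq, vecMass_eq, hv, transpose_mul, Matrix.mul_assoc, Matrix.mul_assoc, ← Matrix.mul_assoc _ U,
    hind, Matrix.mul_assoc, Matrix.mul_assoc, ← Matrix.mul_assoc Uᵀ, hUU, Matrix.one_mul]

/-- A psd block Hankel matrix together with a compatible moment of order `2n + 1` is represented
by a minimal measure. -/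
lemma exists_minimal_vecMoment {S : ℕ → Matrix (Fin p) (Fin p) ℝ}
    (hpsd : (momentMatrix n p S).PosSemidef) (hsymm : ∀ i, i ≤ 2 * n + 1 → (S i).IsSymm)
    (hker : LinearMap.ker (momentMatrix n p S).mulVecLin ≤
      LinearMap.ker (locM (n + 1) p S).mulVecLin) :
    ∃ (ξ : Fin (momentMatrix n p S).rank → ℝ)
      (v : Matrix (Fin (momentMatrix n p S).rank) (Fin p) ℝ),
      ∀ i, i ≤ 2 * n + 1 → S i = vecMoment ξ v i := by
  classical
  obtain ⟨Φ₀, hΦ₀⟩ := hpsd.exists_eq_transpose_mul_self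
  obtain ⟨Ψ₀, hΨ₀⟩ := exists_right_inverse_of_rank_eq Φ₀
    (by rw [Fintype.card_fin, ← rank_transpose_mul_self, ← hΦ₀])
  set K := locM (n + 1) p S with hKdef
  have hKsymm : Kᵀ = K := by
    ext ⟨i, b⟩ ⟨j, c⟩
    have := congrFun (congrFun (hsymm (i + j + 1) (by omega)) b) c
    simp only [transpose_apply, hKdef, locM] at this ⊢
    rw [← this, add_comm j.1 i.1]
  have hKproj : K * (Ψ₀ * Φ₀) = K := by
    rw [eq_comm, ← sub_eq_zero, ← Matrix.mul_one K, Matrix.mul_assoc, Matrix.one_mul,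
      ← Matrix.mul_sub]
    apply Matrix.ext_of_mulVec_single
    intro i
    rw [zero_mulVec, ← mulVec_mulVec]
    apply LinearMap.mem_ker.1 (hker _)
    have h0 : momentMatrix n p S * (1 - Ψ₀ * Φ₀) = 0 := by
      refine (congrArg (· * (1 - Ψ₀ * Φ₀)) hΦ₀).trans ?_
      simp only [Matrix.mul_assoc, Matrix.mul_sub, Matrix.mul_one]
      rw [← Matrix.mul_assoc Φ₀, hΨ₀, Matrix.one_mul, sub_self]
    rw [LinearMap.mem_ker, mulVecLin_apply, mulVec_mulVec, h0, zero_mulVec]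
  have hXsymm : (Ψ₀ᵀ * K * Ψ₀).IsSymm := by
    rw [IsSymm, transpose_mul, transpose_mul, hKsymm, transpose_transpose, Matrix.mul_assoc]
  obtain ⟨U, ξ, hUU, hUU', hX⟩ := hXsymm.exists_orthogonal_diagonal
  set Φ := Uᵀ * Φ₀ with hΦ
  have hM : momentMatrix n p S = Φᵀ * Φ := by
    rw [hΦ, transpose_mul, transpose_transpose, Matrix.mul_assoc, ← Matrix.mul_assoc U, hUU,
      Matrix.one_mul, ← hΦ₀]
  have hK : K = Φᵀ * diagonal ξ * Φ := by
    have hKproj' : (Ψ₀ * Φ₀)ᵀ * K = K := by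
      have := congrArg transpose hKproj
      rwa [transpose_mul, hKsymm] at this
    calc K = (Ψ₀ * Φ₀)ᵀ * (K * (Ψ₀ * Φ₀)) := by rw [hKproj, hKproj']
      _ = Φ₀ᵀ * (Ψ₀ᵀ * K * Ψ₀) * Φ₀ := by simp only [transpose_mul, Matrix.mul_assoc]
      _ = Φᵀ * diagonal ξ * Φ := by
          rw [hX, hΦ]; simp only [transpose_mul, transpose_transpose, Matrix.mul_assoc]
  have hinv : (Ψ₀ * U)ᵀ * Φᵀ = 1 := by
    rw [← transpose_mul, hΦ, Matrix.mul_assoc, ← Matrix.mul_assoc Φ₀, hΨ₀, Matrix.one_mul, hUU',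
      transpose_one]
  have hcancel : ∀ a b, Φᵀ *ᵥ a = Φᵀ *ᵥ b → a = b := fun a b hab => by
    rw [← one_mulVec a, ← one_mulVec b, ← hinv, ← mulVec_mulVec, hab, mulVec_mulVec]
  have hstep : ∀ k (hk : k + 1 < n + 1) r b, Φ r (⟨k + 1, hk⟩, b) = ξ r * Φ r (⟨k, by omega⟩, b) := by
    intro k hk r b
    refine congrFun (hcancel (fun r => Φ r (⟨k + 1, hk⟩, b))
      (fun r => ξ r * Φ r (⟨k, by omega⟩, b)) ?_) r
    ext ⟨i, c⟩
    have h1 := congrFun (congrFun hM (i, c)) (⟨k + 1, hk⟩, b)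
    have h2 := congrFun (congrFun hK (i, c)) (⟨k, by omega⟩, b)
    rw [mul_apply] at h1 h2
    simp only [mul_diagonal] at h2
    simp only [mulVec, dotProduct]
    rw [← h1]
    simp only [← mul_assoc]
    rw [← h2]
    simp only [momentMatrix, hKdef, locM, add_assoc]
  have hpow : ∀ k (hk : k < n + 1) r b, Φ r (⟨k, hk⟩, b) = ξ r ^ k * Φ r (0, b) := by
    intro k
    induction k with
    | zero => intro hk r b; simp
    | succ k ih => intro hk r b; rw [hstep, ih, pow_succ]; ring
  refine ⟨ξ, fun r b => Φ r (0, b), fun i hi => ?_⟩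
  ext b c
  by_cases hin : i = 2 * n + 1
  · have h2 := congrFun (congrFun hK (Fin.last n, b)) (Fin.last n, c)
    rw [mul_apply] at h2
    simp only [mul_diagonal, hKdef, locM, Fin.val_last, transpose_apply] at h2
    rw [hin, two_mul, h2]
    refine Finset.sum_congr rfl fun r _ => ?_
    rw [Fin.last, hpow n _ r b, hpow n _ r c]
    ring
  · obtain ⟨k, l, hk, hl, rfl⟩ : ∃ k l, k < n + 1 ∧ l < n + 1 ∧ i = k + l :=
      ⟨min i n, i - min i n, by omega, by omega, by omega⟩
    have h1 := congrFun (congrFun hM (⟨k, hk⟩, b)) (⟨l, hl⟩, c)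
    rw [mul_apply] at h1
    simp only [momentMatrix, transpose_apply] at h1
    rw [h1]
    refine Finset.sum_congr rfl fun r _ => ?_
    rw [hpow k hk r b, hpow l hl r c]
    ring

end VecMeasure

section Atoms

variable {n p ℓ : ℕ}

/-- A finitely atomic matrix measure splits into vectors, `rank (A j)` of them at `x j`. -/
lemma exists_vec_of_atoms (x : Fin ℓ → ℝ) {A : Fin ℓ → Matrix (Fin p) (Fin p) ℝ}
    (hA : ∀ j, (A j).PosSemidef) :
    ∃ v : Matrix (Σ j, Fin (A j).rank) (Fin p) ℝ,
      (∀ i, ∑ j, x j ^ i • A j = vecMoment (fun r => x r.1) v i) ∧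
      massAt x A = vecMass (fun r => x r.1) v := by
  choose V hV using fun j => (hA j).exists_eq_transpose_mul_self
  have hV' : ∀ j b c, A j b c = ∑ a, V j a b * V j a c := fun j b c => by
    conv_lhs => rw [hV j]
    rw [mul_apply]
    rfl
  refine ⟨fun r b => V r.1 r.2 b, fun i => ?_, ?_⟩
  · ext b c
    simp only [vecMoment, Fintype.sum_sigma, Matrix.sum_apply, Matrix.smul_apply, smul_eq_mul, hV',
      Finset.mul_sum]
  · funext s
    ext b c
    simp only [massAt, vecMass, Fintype.sum_sigma, Matrix.sum_apply]
    refine Finset.sum_congr rfl fun j _ => ?_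
    split_ifs
    · rw [hV']
    · simp

lemma MultEq.ncard_eq {x : Fin ℓ → ℝ} {A : Fin ℓ → Matrix (Fin p) (Fin p) ℝ} {t : ℝ} {m : ℕ}
    (hx : Function.Injective x) (h : MultEq x A t m) :
    {r : Σ j, Fin (A j).rank | x r.1 = t}.ncard = m := by
  rcases h with ⟨j, hj, hm⟩ | ⟨hne, rfl⟩
  · have : {r : Σ j, Fin (A j).rank | x r.1 = t} = Set.range (Sigma.mk j) := by
      ext ⟨j', a⟩
      simp only [Set.mem_ofPred_eq, Set.mem_range, Sigma.mk.injEq]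
      constructor
      · intro h'
        obtain rfl : j = j' := hx (hj.trans h'.symm)
        exact ⟨a, rfl, HEq.rfl⟩
      · rintro ⟨a, rfl, -⟩
        exact hj
    rw [this, ← Set.image_univ, Set.ncard_image_of_injective _ sigma_mk_injective,
      Set.ncard_univ, Nat.card_fin, hm]
  · rw [Set.ncard_eq_zero]
    ext r
    simpa using hne r.1

lemma rank_momentMatrix_le {S : ℕ → Matrix (Fin p) (Fin p) ℝ} {x : Fin ℓ → ℝ}
    {A : Fin ℓ → Matrix (Fin p) (Fin p) ℝ} (hA : ∀ j, (A j).PosSemidef)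
    (hS : ∀ i, i ≤ 2 * n → S i = ∑ j, x j ^ i • A j) :
    (momentMatrix n p S).rank ≤ ∑ j, (A j).rank := by
  obtain ⟨v, hv, -⟩ := exists_vec_of_atoms x hA
  rw [momentMatrix_eq_evalMat fun i hi => (hS i hi).trans (hv i), rank_transpose_mul_self]
  refine (rank_le_card_height _).trans ?_
  simp [Fintype.card_sigma]

lemma sum_pow_smul_eq_of_massAt_eq {ℓ' : ℕ} {x : Fin ℓ → ℝ}
    {A : Fin ℓ → Matrix (Fin p) (Fin p) ℝ} {x' : Fin ℓ' → ℝ}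
    {A' : Fin ℓ' → Matrix (Fin p) (Fin p) ℝ} (h : massAt x A = massAt x' A') (i : ℕ) :
    ∑ j, x j ^ i • A j = ∑ j, x' j ^ i • A' j := by
  have key : ∀ {k : ℕ} (y : Fin k → ℝ) (D : Fin k → Matrix (Fin p) (Fin p) ℝ) (F : Finset ℝ),
      (∀ j, y j ∈ F) → ∑ j, y j ^ i • D j = ∑ s ∈ F, s ^ i • massAt y D s := by
    intro k y D F hF
    simp only [massAt, Finset.smul_sum, smul_ite, smul_zero]
    rw [Finset.sum_comm]
    refine Finset.sum_congr rfl fun j _ => ?_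
    rw [Finset.sum_ite_eq, if_pos (hF j)]
  rw [key x A (univ.image x ∪ univ.image x') (fun j => by simp), h,
    key x' A' (univ.image x ∪ univ.image x') (fun j => by simp)]

lemma rank_evalMat_sub_le {R : Type*} (n : ℕ) (ξ : R → ℝ) (v : Matrix R (Fin p) ℝ) (t : ℝ) :
    (evalMat n (fun r => ξ r - t) v).rank ≤ (evalMat n ξ v).rank := by
  let C : Matrix (Fin (n + 1) × Fin p) (Fin (n + 1) × Fin p) ℝ := fun kb lc =>
    if kb.2 = lc.2 then (-t) ^ (lc.1.1 - kb.1.1) * (lc.1.1.choose kb.1.1) else 0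
  have : evalMat n (fun r => ξ r - t) v = evalMat n ξ v * C := by
    ext r ⟨l, c⟩
    rw [mul_apply, Fintype.sum_prod_type]
    simp only [evalMat, C, mul_ite, mul_zero, Finset.sum_ite_eq', Finset.mem_univ, if_true]
    rw [Fin.sum_univ_eq_sum_range (fun k => ξ r ^ k * v r c * ((-t) ^ (l.1 - k) * (l.1.choose k)))
      (n + 1), sub_eq_add_neg, add_pow, Finset.sum_mul]
    refine (Finset.sum_congr rfl fun k _ => by ring).trans (Finset.sum_subset
      (Finset.range_subset_range.2 (by omega : l.1 + 1 ≤ n + 1)) fun k _ hk => ?_)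
    rw [Nat.choose_eq_zero_of_lt (by simpa using hk)]
    simp
  rw [this]
  exact rank_mul_le_left _ _

variable {R : Type*} [Fintype R]

lemma vecMass_posSemidef (ξ : R → ℝ) (v : Matrix R (Fin p) ℝ) (s : ℝ) :
    (vecMass ξ v s).PosSemidef := by
  classical
  rw [vecMass_eq, ← conjTranspose_eq_transpose_of_trivial]
  refine PosSemidef.conjTranspose_mul_mul_same (PosSemidef.diagonal fun r => ?_) v
  simp only [Pi.zero_apply]
  split_ifs <;> norm_num

lemma rank_vecMass_le (ξ : R → ℝ) (v : Matrix R (Fin p) ℝ) (s : ℝ) :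
    (vecMass ξ v s).rank ≤ {r | ξ r = s}.ncard := by
  classical
  rw [vecMass_eq]
  refine (rank_mul_le_left _ _).trans ((rank_mul_le_right _ _).trans ?_)
  rw [rank_diagonal, ← Nat.card_coe_set_eq, Nat.card_eq_fintype_card]
  simpa using (Fintype.card_subtype _).le

/-- A family of `rank M(n)` vectors representing `S` yields a minimal representing measure. -/
lemma exists_isRepMeasure_of_vec {S : ℕ → Matrix (Fin p) (Fin p) ℝ} {ξ : R → ℝ}
    {v : Matrix R (Fin p) ℝ} (hS : ∀ i, i ≤ 2 * n → S i = vecMoment ξ v i)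
    (hmin : Fintype.card R = (momentMatrix n p S).rank) :
    ∃ (k : ℕ) (x : Fin k → ℝ) (A : Fin k → Matrix (Fin p) (Fin p) ℝ),
      IsRepMeasure n p S k x A ∧ IsMinimal n p S A ∧
      (∀ t, MultEq x A t {r | ξ r = t}.ncard) ∧ ∀ i, ∑ j, x j ^ i • A j = vecMoment ξ v i := by
  classical
  let F : Finset ℝ := univ.image ξ
  let e : Fin F.card ≃ F := F.equivFin.symm
  let x : Fin F.card → ℝ := fun j => (e j).1
  let A : Fin F.card → Matrix (Fin p) (Fin p) ℝ := fun j => vecMass ξ v (x j)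
  have hx : Function.Injective x := Subtype.val_injective.comp e.injective
  have hsum : ∀ {B : Type} [AddCommMonoid B] (g : ℝ → B), ∑ j, g (x j) = ∑ s ∈ F, g s := by
    intro B _ g
    rw [Equiv.sum_comp e fun s => g s.1, Finset.sum_coe_sort F g]
  have hmom : ∀ i, ∑ j, x j ^ i • A j = vecMoment ξ v i := by
    intro i
    rw [hsum fun s => s ^ i • vecMass ξ v s]
    ext b c
    simp only [Matrix.sum_apply, Matrix.smul_apply, vecMass, vecMoment, smul_eq_mul, Finset.mul_sum, mul_ite,
      mul_zero]
    rw [Finset.sum_comm]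
    refine Finset.sum_congr rfl fun r _ => ?_
    rw [Finset.sum_ite_eq, if_pos (mem_image_of_mem ξ (mem_univ r))]
  have hcount : ∑ j, {r | ξ r = x j}.ncard = Fintype.card R := by
    rw [hsum fun s => {r | ξ r = s}.ncard, ← Finset.card_univ,
      Finset.card_eq_sum_card_image ξ univ]
    refine Finset.sum_congr rfl fun s _ => ?_
    rw [← Set.ncard_coe_finset]
    simp
  have hle := rank_momentMatrix_le (n := n) (fun j => vecMass_posSemidef ξ v (x j))
    (fun i hi => (hS i hi).trans (hmom i).symm)
  have hrank : ∀ j, (A j).rank = {r | ξ r = x j}.ncard := by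
    have := (Finset.sum_eq_sum_iff_of_le fun j (_ : j ∈ univ) => rank_vecMass_le ξ v (x j)).1
      (le_antisymm (Finset.sum_le_sum fun j _ => rank_vecMass_le ξ v (x j))
        (by rw [hcount, hmin]; exact hle))
    exact fun j => this j (mem_univ j)
  refine ⟨F.card, x, A, ⟨hx, fun j => vecMass_posSemidef ξ v (x j), fun j h0 => ?_,
    fun i hi => (hS i hi).trans (hmom i).symm⟩, ?_, fun t => ?_, hmom⟩
  · have h1 := hrank j
    rw [h0, rank_zero, eq_comm, Set.ncard_eq_zero] at h1
    obtain ⟨r, -, hr⟩ := Finset.mem_image.1 (e j).2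
    exact Set.notMem_empty r (h1 ▸ hr)
  · rw [IsMinimal, Finset.sum_congr rfl fun j _ => hrank j, hcount, hmin]
  · by_cases ht : t ∈ F
    · refine Or.inl ⟨e.symm ⟨t, ht⟩, ?_, ?_⟩
      · simp [x]
      · rw [hrank]
        simp [x]
    · refine Or.inr ⟨fun j hj => ht (hj ▸ (e j).2), ?_⟩
      rw [Set.ncard_eq_zero]
      ext r
      simp only [Set.mem_ofPred_eq, Set.mem_empty_iff_false, iff_false]
      rintro rfl
      exact ht (mem_image_of_mem ξ (mem_univ r))

/-- The shifted moments are the moments of the translated measure. -/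
lemma shiftT_eq_vecMoment {S : ℕ → Matrix (Fin p) (Fin p) ℝ} {ξ : R → ℝ} (t : ℝ)
    {v : Matrix R (Fin p) ℝ} {N : ℕ} (hS : ∀ i, i ≤ N → S i = vecMoment ξ v i) (i : ℕ)
    (hi : i ≤ N) : shiftT p t S i = vecMoment (fun r => ξ r - t) v i := by
  ext b c
  simp only [shiftT, Matrix.sum_apply, Matrix.smul_apply, smul_eq_mul]
  rw [Finset.sum_congr rfl fun l _ => by rw [hS (i - l) (by omega)]]
  simp only [vecMoment, Finset.mul_sum]
  rw [Finset.sum_comm]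
  refine Finset.sum_congr rfl fun r _ => ?_
  rw [sub_eq_neg_add, add_pow, Finset.sum_mul]
  refine Finset.sum_congr rfl fun l _ => ?_
  rw [neg_pow t l]
  ring

lemma rank_momentMatrix_shiftT {S : ℕ → Matrix (Fin p) (Fin p) ℝ} {ξ : R → ℝ} (t : ℝ)
    {v : Matrix R (Fin p) ℝ} (hS : ∀ i, i ≤ 2 * n → S i = vecMoment ξ v i) :
    (momentMatrix n p (shiftT p t S)).rank = (momentMatrix n p S).rank := by
  rw [momentMatrix_eq_evalMat (shiftT_eq_vecMoment t hS), momentMatrix_eq_evalMat hS,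
    rank_transpose_mul_self, rank_transpose_mul_self]
  refine le_antisymm (rank_evalMat_sub_le n ξ v t) ?_
  simpa using rank_evalMat_sub_le n (fun r => ξ r - t) v (-t)

end Atoms

/-- The block Hankel matrix `(T_{i+k+s})` with `a` block rows and `b` block columns. -/
def blockHankel {p : ℕ} (a b s : ℕ) (T : ℕ → Matrix (Fin p) (Fin p) ℝ) :
    Matrix (Fin a × Fin p) (Fin b × Fin p) ℝ :=
  fun ia kb => T (ia.1.1 + kb.1.1 + s) ia.2 kb.2

/-- The position of a block index in the usual linear order of the columns. -/
def blockOrd {b p : ℕ} (kb : Fin b × Fin p) : ℕ := kb.1.1 * p + kb.2.1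

/-- The last block of a block vector. -/
def lastBlock (n p : ℕ) : (Fin (n + 1) × Fin p → ℝ) →ₗ[ℝ] (Fin p → ℝ) :=
  LinearMap.funLeft ℝ ℝ fun i => (Fin.last n, i)

/-- The last blocks of the vectors in the kernel of a block Hankel matrix. -/
def lastKer {p : ℕ} (a n s : ℕ) (T : ℕ → Matrix (Fin p) (Fin p) ℝ) : Submodule ℝ (Fin p → ℝ) :=
  (LinearMap.ker (blockHankel a (n + 1) s T).mulVecLin).map (lastBlock n p)

section Blocks

variable {n p a b s : ℕ} {T T' : ℕ → Matrix (Fin p) (Fin p) ℝ}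

lemma blockOrd_injective : Function.Injective (blockOrd : Fin b × Fin p → ℕ) := by
  rintro ⟨k, i⟩ ⟨l, j⟩ h
  have hp : 0 < p := i.pos
  simp only [blockOrd] at h
  have h1 : (k.1 * p + i.1) / p = k.1 := by
    rw [mul_comm, Nat.mul_add_div hp, Nat.div_eq_of_lt i.2, add_zero]
  have h2 : (l.1 * p + j.1) / p = l.1 := by
    rw [mul_comm, Nat.mul_add_div hp, Nat.div_eq_of_lt j.2, add_zero]
  have h3 : k.1 = l.1 := by rw [← h1, ← h2, h]
  rw [h3] at h
  exact Prod.ext (Fin.ext h3) (Fin.ext (by simpa using h))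

lemma colM2_eq_col (hp : 0 < p) (k : Fin b) (i : Fin p) :
    colM2 a p hp T ((k.1 + s) * p + (i.1 + 1)) = (blockHankel a b s T).col (k, i) := by
  have h1 : ((k.1 + s) * p + i.1) / p = k.1 + s := by
    rw [mul_comm, Nat.mul_add_div hp, Nat.div_eq_of_lt i.2, add_zero]
  have h2 : ((k.1 + s) * p + i.1) % p = i.1 := by
    rw [mul_comm, Nat.mul_add_mod, Nat.mod_eq_of_lt i.2]
  funext ⟨j, c⟩
  simp only [colM2, col_apply, blockHankel, ← Nat.add_assoc, Nat.add_sub_cancel]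
  simp only [h1, h2, ← Nat.add_assoc]

/-- The pivots of the kernel of a block Hankel matrix are its linearly dependent columns. -/
lemma isPivot_ker_blockHankel_iff (hp : 0 < p) (k : Fin b) (i : Fin p) :
    IsPivot blockOrd (LinearMap.ker (blockHankel a b s T).mulVecLin) (k, i) ↔
      colM2 a p hp T ((k.1 + s) * p + (i.1 + 1)) ∈ Submodule.span ℝ
        (colM2 a p hp T '' Set.Icc (s * p + 1) ((k.1 + s) * p + (i.1 + 1) - 1)) := by
  rw [isPivot_ker_mulVecLin_iff blockOrd_injective, colM2_eq_col hp k i]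
  have : (blockHankel a b s T).col '' {kb | blockOrd kb < blockOrd (k, i)} =
      colM2 a p hp T '' Set.Icc (s * p + 1) ((k.1 + s) * p + (i.1 + 1) - 1) := by
    ext y
    constructor
    · rintro ⟨⟨l, j⟩, hlj, rfl⟩
      refine ⟨(l.1 + s) * p + (j.1 + 1), ?_, colM2_eq_col hp l j⟩
      simp only [blockOrd, Set.mem_ofPred_eq] at hlj
      rw [Set.mem_Icc, add_mul, add_mul]
      omega
    · rintro ⟨j, hj, rfl⟩
      rw [Set.mem_Icc, add_mul] at hj
      obtain ⟨q, rfl⟩ : ∃ q, j = s * p + q + 1 := ⟨j - 1 - s * p, by omega⟩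
      have hq : q < k.1 * p + i.1 := by omega
      have hqb : q / p < b := by
        refine lt_of_le_of_lt (Nat.lt_succ_iff.1 ?_) k.2
        rw [Nat.div_lt_iff_lt_mul hp, Nat.succ_mul]
        omega
      have hqp := Nat.div_add_mod q p
      rw [mul_comm] at hqp
      refine ⟨(⟨q / p, hqb⟩, ⟨q % p, Nat.mod_lt _ hp⟩), ?_, ?_⟩
      · simp only [blockOrd, Set.mem_ofPred_eq]
        omega
      · rw [← colM2_eq_col hp]
        congr 1
        simp only [add_mul]
        omega
  rw [this]

lemma isPivot_ker_castSucc_iff (k : Fin b) (i : Fin p) :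
    IsPivot blockOrd (LinearMap.ker (blockHankel a (b + 1) s T).mulVecLin) (k.castSucc, i) ↔
      IsPivot blockOrd (LinearMap.ker (blockHankel a b s T).mulVecLin) (k, i) := by
  rw [isPivot_ker_blockHankel_iff i.pos, isPivot_ker_blockHankel_iff i.pos]
  rfl

lemma isPivot_map_lastBlock_iff (W : Submodule ℝ (Fin (n + 1) × Fin p → ℝ)) (i : Fin p) :
    IsPivot Fin.val (W.map (lastBlock n p)) i ↔ IsPivot blockOrd W (Fin.last n, i) := by
  constructor
  · rintro ⟨_, ⟨w, hw, rfl⟩, h1, h0⟩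
    refine ⟨w, hw, h1, ?_⟩
    rintro ⟨k, j⟩ hk
    simp only [blockOrd, Fin.val_last] at hk
    have hkn : k.1 = n := by
      refine le_antisymm (Nat.lt_succ_iff.1 k.2) (not_lt.1 fun hlt => ?_)
      have : (k.1 + 1) * p ≤ n * p := Nat.mul_le_mul_right p hlt
      rw [add_mul] at this
      have := j.2
      omega
    obtain rfl : k = Fin.last n := Fin.ext hkn
    exact h0 j (by simpa using hk)
  · rintro ⟨w, hw, h1, h0⟩
    refine ⟨_, ⟨w, hw, rfl⟩, h1, fun j hj => h0 _ ?_⟩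
    simpa [blockOrd] using hj

lemma isPivot_lastKer_iff (i : Fin p) : IsPivot Fin.val (lastKer a n s T) i ↔
    IsPivot blockOrd (LinearMap.ker (blockHankel a (n + 1) s T).mulVecLin) (Fin.last n, i) :=
  isPivot_map_lastBlock_iff _ i

lemma ncard_block_succ (P : Fin (n + 1) × Fin p → Prop) :
    {x | P x}.ncard = {x : Fin n × Fin p | P (x.1.castSucc, x.2)}.ncard +
      {i : Fin p | P (Fin.last n, i)}.ncard := by
  classical
  simp only [Set.ncard_eq_toFinset_card', Set.toFinset_ofPred, Finset.card_filter]
  rw [Fintype.sum_prod_type, Fin.sum_univ_castSucc, Fintype.sum_prod_type]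

lemma finrank_ker_blockHankel_succ :
    Module.finrank ℝ (LinearMap.ker (blockHankel a (n + 1) s T).mulVecLin) =
      Module.finrank ℝ (LinearMap.ker (blockHankel a n s T).mulVecLin) +
      Module.finrank ℝ (lastKer a n s T) := by
  rw [← ncard_isPivot blockOrd_injective, ncard_block_succ, ← ncard_isPivot blockOrd_injective,
    ← ncard_isPivot Fin.val_injective]
  simp only [isPivot_ker_castSucc_iff, isPivot_lastKer_iff]

lemma blockHankel_mulVec_succ (f : Fin (n + 1) × Fin p → ℝ) (i : Fin a) (c : Fin p) :
    (blockHankel a (n + 1) s T *ᵥ f) (i, c) =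
      (blockHankel a n s T *ᵥ fun kb => f (kb.1.castSucc, kb.2)) (i, c) +
        (T (i + n + s) *ᵥ lastBlock n p f) c := by
  simp only [mulVec, dotProduct, Fintype.sum_prod_type, Fin.sum_univ_castSucc]
  rfl

lemma blockHankel_mulVec_shift (f : Fin n × Fin p → ℝ) (i : Fin a) (c : Fin p) :
    (blockHankel a (n + 1) 0 T *ᵥ fun kb => Fin.cases 0 (fun k => f (k, kb.2)) kb.1) (i, c) =
      (blockHankel a n 1 T *ᵥ f) (i, c) := by
  simp only [mulVec, dotProduct, Fintype.sum_prod_type, Fin.sum_univ_succ]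
  simp [blockHankel, add_assoc]

/-- Block vectors with prescribed last block and prescribed remaining blocks. -/
lemma exists_block_eq (f : Fin n × Fin p → ℝ) (g : Fin p → ℝ) :
    ∃ F : Fin (n + 1) × Fin p → ℝ, (fun kb : Fin n × Fin p => F (kb.1.castSucc, kb.2)) = f ∧
      lastBlock n p F = g :=
  ⟨fun kb => Fin.lastCases (g kb.2) (fun k => f (k, kb.2)) kb.1, by ext; simp,
    by ext; simp [lastBlock, LinearMap.funLeft_apply]⟩

lemma blockHankel_congr {N : ℕ} (h : ∀ i, i ≤ N → T i = T' i) (hN : a + b + s ≤ N + 2) :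
    blockHankel a b s T = blockHankel a b s T' := by
  ext ⟨i, c⟩ ⟨k, d⟩
  simp only [blockHankel]
  rw [h _ (by omega)]

lemma momentMatrix_eq_blockHankel (n : ℕ) (T : ℕ → Matrix (Fin p) (Fin p) ℝ) :
    momentMatrix n p T = blockHankel (n + 1) (n + 1) 0 T := rfl

lemma locM_eq_blockHankel (n : ℕ) (T : ℕ → Matrix (Fin p) (Fin p) ℝ) :
    locM n p T = blockHankel n n 1 T := rfl

lemma ker_blockHankel_le
    (hK : LinearMap.ker (momentMatrix n p T).mulVecLin ≤
      LinearMap.ker (locM (n + 1) p T').mulVecLin) (hT : ∀ i, i ≤ 2 * n → T i = T' i) :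
    LinearMap.ker (blockHankel (n + 1) n 0 T).mulVecLin ≤
      LinearMap.ker (blockHankel (n + 1) n 1 T).mulVecLin := by
  intro f hf
  obtain ⟨F, hF, hF0⟩ := exists_block_eq f 0
  rw [LinearMap.mem_ker, mulVecLin_apply] at hf ⊢
  have h1 : momentMatrix n p T *ᵥ F = 0 := by
    ext ⟨i, c⟩
    have := blockHankel_mulVec_succ (a := n + 1) (s := 0) (T := T) F i c
    rw [hF, hF0, mulVec_zero, hf] at this
    rw [momentMatrix_eq_blockHankel, this]
    simp
  have h2 : locM (n + 1) p T' *ᵥ F = 0 := hK h1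
  ext ⟨i, c⟩
  have := blockHankel_mulVec_succ (a := n + 1) (s := 1) (T := T') F i c
  rw [hF, hF0, mulVec_zero, ← blockHankel_congr (b := n) hT (by omega)] at this
  have h3 : (blockHankel (n + 1) (n + 1) 1 T' *ᵥ F) (i, c) = 0 := congrFun h2 (i, c)
  rw [h3] at this
  simpa using this.symm

/-- Dependent columns of `ℳ₁` without its first block shift to dependent columns of `ℳ₁`. -/
lemma IsPivot.shift {k : Fin n} {i : Fin p}
    (h : IsPivot blockOrd (LinearMap.ker (blockHankel a n 1 T).mulVecLin) (k, i)) :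
    IsPivot blockOrd (LinearMap.ker (blockHankel a (n + 1) 0 T).mulVecLin) (k.succ, i) := by
  obtain ⟨w, hw, h1, h0⟩ := h
  refine ⟨fun kb => Fin.cases 0 (fun k => w (k, kb.2)) kb.1, ?_, by simpa using h1, ?_⟩
  · rw [LinearMap.mem_ker, mulVecLin_apply] at hw ⊢
    ext ⟨j, c⟩
    rw [blockHankel_mulVec_shift, hw]
  · rintro ⟨l, j⟩ hl
    induction l using Fin.cases with
    | zero => rfl
    | succ l =>
      refine h0 (l, j) ?_
      simp only [blockOrd, Fin.val_succ, add_mul] at hl ⊢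
      omega

lemma IsPivot.of_ker_le
    (hN : LinearMap.ker (blockHankel (n + 1) n 0 T).mulVecLin ≤
      LinearMap.ker (blockHankel (n + 1) n 1 T).mulVecLin) {k : Fin n} {i : Fin p}
    (h : IsPivot blockOrd (LinearMap.ker (blockHankel (n + 1) (n + 1) 0 T).mulVecLin)
      (k.castSucc, i)) :
    IsPivot blockOrd (LinearMap.ker (blockHankel (n + 1) n 1 T).mulVecLin) (k, i) := by
  obtain ⟨w, hw, h'⟩ := (isPivot_ker_castSucc_iff k i).1 h
  exact ⟨w, hN hw, h'⟩

lemma IsPivot.block_mono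
    (hN : LinearMap.ker (blockHankel (n + 1) n 0 T).mulVecLin ≤
      LinearMap.ker (blockHankel (n + 1) n 1 T).mulVecLin) {k l : Fin (n + 1)} {i : Fin p}
    (h : IsPivot blockOrd (LinearMap.ker (blockHankel (n + 1) (n + 1) 0 T).mulVecLin) (k, i))
    (hkl : k ≤ l) :
    IsPivot blockOrd (LinearMap.ker (blockHankel (n + 1) (n + 1) 0 T).mulVecLin) (l, i) := by
  induction l using Fin.induction with
  | zero => rwa [← Fin.le_zero_iff.1 hkl]
  | succ l ih =>
    rcases hkl.eq_or_lt with rfl | hlt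
    · exact h
    · exact ((ih (Fin.le_castSucc_iff.2 hlt)).of_ker_le hN).shift

lemma colM1_eq_colM2 (hp : 0 < p) : colM1 n p hp T = colM2 (n + 1) p hp T := rfl

lemma mem_setA_iff (hp : 0 < p) (i : Fin p) : i.1 + 1 ∈ setA n p hp T ↔ ∃ k : Fin n,
    IsPivot blockOrd (LinearMap.ker (blockHankel (n + 1) n 1 T).mulVecLin) (k, i) ∧
    ¬ IsPivot blockOrd (LinearMap.ker (blockHankel (n + 1) (n + 1) 0 T).mulVecLin)
      (k.castSucc, i) := by
  simp only [isPivot_ker_blockHankel_iff hp]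
  constructor
  · rintro ⟨-, k, hk, h1, h2⟩
    obtain ⟨k, rfl⟩ : ∃ l, k = l + 1 := ⟨k - 1, by have := hk.1; omega⟩
    refine ⟨⟨k, hk.2⟩, ?_, ?_⟩
    · simpa only [one_mul, colM1_eq_colM2] using h1
    · simpa only [Fin.val_castSucc, add_zero, zero_mul, zero_add, colM1_eq_colM2,
        Nat.add_sub_cancel] using h2
  · rintro ⟨k, h1, h2⟩
    refine ⟨⟨by omega, i.2⟩, k.1 + 1, ⟨by omega, k.2⟩, ?_, ?_⟩
    · simpa only [one_mul, colM1_eq_colM2] using h1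
    · simpa only [Fin.val_castSucc, add_zero, zero_mul, zero_add, colM1_eq_colM2,
        Nat.add_sub_cancel] using h2

lemma mem_setB_iff (hp : 0 < p) (i : Fin p) : i.1 + 1 ∈ setB n p hp T ↔
    IsPivot Fin.val (lastKer n n 1 T) i ∧ ¬ IsPivot Fin.val (lastKer (n + 1) n 0 T) i := by
  simp only [isPivot_lastKer_iff, isPivot_ker_blockHankel_iff hp, Fin.val_last, one_mul, zero_mul,
    zero_add, add_zero]
  exact ⟨fun h => h.2, fun h => ⟨⟨by omega, i.2⟩, h⟩⟩

lemma exists_fin_of_mem_Icc {j : ℕ} (hj : j ∈ Set.Icc 1 p) : ∃ i : Fin p, i.1 + 1 = j :=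
  ⟨⟨j - 1, by have := hj.1; have := hj.2; omega⟩, by have := hj.1; simp; omega⟩

lemma lastKer_zero_le : lastKer (n + 1) n 0 T ≤ lastKer n n 1 T := by
  refine Submodule.map_mono fun f hf => ?_
  rw [LinearMap.mem_ker, mulVecLin_apply] at hf ⊢
  ext ⟨i, c⟩
  have := congrFun hf (i.succ, c)
  simp only [mulVec, dotProduct, blockHankel, Fin.val_succ, add_zero, Pi.zero_apply] at this ⊢
  simpa only [add_right_comm] using this

lemma IsPivot.mono {ι : Type*} {ord : ι → ℕ} {W W' : Submodule ℝ (ι → ℝ)} (hW : W ≤ W') {i : ι}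
    (h : IsPivot ord W i) : IsPivot ord W' i := by
  obtain ⟨w, hw, h'⟩ := h
  exact ⟨w, hW hw, h'⟩

lemma ncard_setB (hp : 0 < p) : (setB n p hp T).ncard +
    Module.finrank ℝ (lastKer (n + 1) n 0 T) = Module.finrank ℝ (lastKer n n 1 T) := by
  have : setB n p hp T = (fun i : Fin p => i.1 + 1) ''
      ({i | IsPivot Fin.val (lastKer n n 1 T) i} \
        {i | IsPivot Fin.val (lastKer (n + 1) n 0 T) i}) := by
    ext j
    constructor
    · intro hj
      obtain ⟨i, rfl⟩ := exists_fin_of_mem_Icc hj.1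
      exact ⟨i, (mem_setB_iff hp i).1 hj, rfl⟩
    · rintro ⟨i, hi, rfl⟩
      exact (mem_setB_iff hp i).2 hi
  rw [this, Set.ncard_image_of_injective _ fun i j h => Fin.ext (Nat.succ_injective h),
    ← ncard_isPivot Fin.val_injective, ← ncard_isPivot Fin.val_injective]
  exact Set.ncard_sdiff_add_ncard_of_subset fun i hi => hi.mono lastKer_zero_le

lemma ncard_setA (hp : 0 < p)
    (hN : LinearMap.ker (blockHankel (n + 1) n 0 T).mulVecLin ≤
      LinearMap.ker (blockHankel (n + 1) n 1 T).mulVecLin) :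
    (setA n p hp T).ncard + Module.finrank ℝ (LinearMap.ker (blockHankel (n + 1) n 0 T).mulVecLin) =
      Module.finrank ℝ (LinearMap.ker (blockHankel (n + 1) n 1 T).mulVecLin) := by
  have : setA n p hp T = (fun x : Fin n × Fin p => x.2.1 + 1) ''
      ({x | IsPivot blockOrd (LinearMap.ker (blockHankel (n + 1) n 1 T).mulVecLin) x} \
        {x | IsPivot blockOrd (LinearMap.ker (blockHankel (n + 1) n 0 T).mulVecLin) x}) := by
    ext j
    constructor
    · intro hj
      obtain ⟨i, rfl⟩ := exists_fin_of_mem_Icc hj.1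
      obtain ⟨k, h1, h2⟩ := (mem_setA_iff hp i).1 hj
      exact ⟨(k, i), ⟨h1, fun h => h2 ((isPivot_ker_castSucc_iff k i).2 h)⟩, rfl⟩
    · rintro ⟨⟨k, i⟩, ⟨h1, h2⟩, rfl⟩
      exact (mem_setA_iff hp i).2 ⟨k, h1, fun h => h2 ((isPivot_ker_castSucc_iff k i).1 h)⟩
  rw [this, Set.InjOn.ncard_image, ← ncard_isPivot blockOrd_injective,
    ← ncard_isPivot blockOrd_injective]
  · exact Set.ncard_sdiff_add_ncard_of_subset fun i hi => hi.mono hN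
  · have key : ∀ {k l : Fin n} {i : Fin p}, k < l →
        IsPivot blockOrd (LinearMap.ker (blockHankel (n + 1) n 1 T).mulVecLin) (k, i) →
        IsPivot blockOrd (LinearMap.ker (blockHankel (n + 1) n 0 T).mulVecLin) (l, i) :=
      fun {k l i} hkl h => (isPivot_ker_castSucc_iff l i).1 (h.shift.block_mono hN hkl)
    rintro ⟨k, i⟩ ⟨h1, h2⟩ ⟨l, j⟩ ⟨h1', h2'⟩ hij
    obtain rfl : i = j := Fin.ext (Nat.succ_injective hij)
    rcases lt_trichotomy k l with h | rfl | h
    · exact absurd (key h h1) h2'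
    · rfl
    · exact absurd (key h h1') h2

lemma ncard_setA_union_setB (hp : 0 < p)
    (hN : LinearMap.ker (blockHankel (n + 1) n 0 T).mulVecLin ≤
      LinearMap.ker (blockHankel (n + 1) n 1 T).mulVecLin) :
    (setA n p hp T ∪ setB n p hp T).ncard = (setA n p hp T).ncard + (setB n p hp T).ncard := by
  refine Set.ncard_union_eq (Set.disjoint_left.2 fun j hA hB => ?_)
    ((Set.finite_Icc 1 p).subset fun _ h => h.1) ((Set.finite_Icc 1 p).subset fun _ h => h.1)
  obtain ⟨i, rfl⟩ := exists_fin_of_mem_Icc hA.1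
  obtain ⟨k, h1, -⟩ := (mem_setA_iff hp i).1 hA
  exact ((mem_setB_iff hp i).1 hB).2
    ((isPivot_lastKer_iff i).2 (h1.shift.block_mono hN (Fin.le_last _)))

/-- The number of atoms at the origin of a minimal representation, in terms of the last blocks
of the kernels of the block Hankel matrices. -/
lemma ncard_zero_add_finrank {R : Type*} [Fintype R] (hp : 0 < p) {ξ : R → ℝ}
    {v : Matrix R (Fin p) ℝ} (hT : ∀ i, i ≤ 2 * n → T i = vecMoment ξ v i)
    (hT' : ∀ i, i ≤ 2 * n + 1 → T' i = vecMoment ξ v i)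
    (hmin : Fintype.card R = (momentMatrix n p T).rank) :
    {r | ξ r = 0}.ncard + Module.finrank ℝ (lastKer (n + 1) n 0 T) =
      (setA n p hp T).ncard + Module.finrank ℝ (lastKer (n + 1) n 1 T') := by
  have hTT' : ∀ i, i ≤ 2 * n → T i = T' i := fun i hi => by rw [hT i hi, hT' i (by omega)]
  have hA := ncard_setA hp (ker_blockHankel_le (ker_mulVecLin_le_of_moments hT hT') hTT')
  have h1 := rank_locM_add_ncard hT hT' hmin
  have h2 := (momentMatrix n p T).mulVecLin.finrank_range_add_finrank_ker
  have h3 := (locM (n + 1) p T').mulVecLin.finrank_range_add_finrank_ker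
  rw [← Matrix.rank, momentMatrix_eq_blockHankel, finrank_ker_blockHankel_succ] at h2
  rw [← Matrix.rank, locM_eq_blockHankel, finrank_ker_blockHankel_succ,
    ← blockHankel_congr (b := n) hTT' (by omega)] at h3
  rw [momentMatrix_eq_blockHankel, locM_eq_blockHankel] at h1
  omega

end Blocks

/-- The last block column of the block Hankel matrix `(T_{i+k+s})` with `n + 1` block columns. -/
def lastCol {p : ℕ} (a n s : ℕ) (T : ℕ → Matrix (Fin p) (Fin p) ℝ) :
    Matrix (Fin a × Fin p) (Fin p) ℝ :=
  fun ia c => T (ia.1.1 + n + s) ia.2 c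

section Completion

variable {n p : ℕ} {T T' : ℕ → Matrix (Fin p) (Fin p) ℝ}

lemma vecMoment_isSymm {R : Type*} [Fintype R] (ξ : R → ℝ) (v : Matrix R (Fin p) ℝ) (i : ℕ) :
    (vecMoment ξ v i).IsSymm := by
  ext b c
  simp only [transpose_apply, vecMoment, mul_comm]

lemma locM_isSymm (hT : ∀ i, i ≤ 2 * n → (T i).IsSymm) : (locM n p T).IsSymm := by
  ext ⟨i, c⟩ ⟨k, d⟩
  simp only [transpose_apply, locM]
  rw [(hT _ (by omega)).apply, add_comm k.1]

lemma blockHankel_succ_mulVec {a s : ℕ} (F : Fin (n + 1) × Fin p → ℝ) :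
    blockHankel a (n + 1) s T *ᵥ F =
      (blockHankel a n s T *ᵥ fun kb => F (kb.1.castSucc, kb.2)) +
        lastCol a n s T *ᵥ lastBlock n p F :=
  funext fun ⟨i, c⟩ => blockHankel_mulVec_succ F i c

lemma mem_lastKer_iff {a s : ℕ} {g : Fin p → ℝ} :
    g ∈ lastKer a n s T ↔ ∃ f, blockHankel a n s T *ᵥ f + lastCol a n s T *ᵥ g = 0 := by
  constructor
  · rintro ⟨F, hF, rfl⟩
    exact ⟨_, (blockHankel_succ_mulVec F).symm.trans hF⟩
  · rintro ⟨f, hf⟩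
    obtain ⟨F, rfl, rfl⟩ := exists_block_eq f g
    exact ⟨F, (blockHankel_succ_mulVec F).trans hf, rfl⟩

lemma locM_succ_mulVec_eq_zero_iff (hT : ∀ i, i ≤ 2 * n + 1 → (T i).IsSymm)
    (f : Fin n × Fin p → ℝ) (g : Fin p → ℝ) :
    blockHankel (n + 1) n 1 T *ᵥ f + lastCol (n + 1) n 1 T *ᵥ g = 0 ↔
      locM n p T *ᵥ f + lastCol n n 1 T *ᵥ g = 0 ∧
        (lastCol n n 1 T)ᵀ *ᵥ f + T (2 * n + 1) *ᵥ g = 0 := by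
  have h1 : ∀ (i : Fin n) (c : Fin p),
      (blockHankel (n + 1) n 1 T *ᵥ f + lastCol (n + 1) n 1 T *ᵥ g) (i.castSucc, c) =
        (locM n p T *ᵥ f + lastCol n n 1 T *ᵥ g) (i, c) := fun i c => rfl
  have h2 : ∀ c : Fin p,
      (blockHankel (n + 1) n 1 T *ᵥ f + lastCol (n + 1) n 1 T *ᵥ g) (Fin.last n, c) =
        ((lastCol n n 1 T)ᵀ *ᵥ f + T (2 * n + 1) *ᵥ g) c := by
    intro c
    simp only [Pi.add_apply, mulVec, dotProduct, blockHankel, lastCol, transpose_apply,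
      Fin.val_last, ← two_mul]
    congr 1
    refine Finset.sum_congr rfl fun kb _ => ?_
    rw [(hT _ (by omega)).apply, add_comm n]
  constructor
  · intro h
    exact ⟨funext fun ⟨i, c⟩ => (h1 i c).symm.trans (congrFun h _),
      funext fun c => (h2 c).symm.trans (congrFun h _)⟩
  · rintro ⟨h3, h4⟩
    funext ⟨i, c⟩
    induction i using Fin.lastCases with
    | last => exact (h2 c).trans (congrFun h4 c)
    | cast i => exact (h1 i c).trans (congrFun h3 _)

lemma lastKer_succ_le : lastKer (n + 1) n 1 T ≤ lastKer n n 1 T := by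
  intro g hg
  obtain ⟨f, hf⟩ := mem_lastKer_iff.1 hg
  exact mem_lastKer_iff.2 ⟨f, funext fun ⟨i, c⟩ => congrFun hf (i.castSucc, c)⟩

lemma lastCol_congr (h : ∀ i, i ≤ 2 * n → T i = T' i) : lastCol n n 1 T = lastCol n n 1 T' := by
  ext ⟨i, c⟩ d
  simp only [lastCol]
  rw [h _ (by omega)]

lemma lastKer_eq_top_iff (hT : ∀ i, i ≤ 2 * n → (T i).IsSymm) :
    lastKer n n 1 T = ⊤ ↔ ∀ v, locM n p T *ᵥ v = 0 → (lastCol n n 1 T)ᵀ *ᵥ v = 0 := by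
  have hH := locM_isSymm hT
  constructor
  · intro h v hv
    refine dotProduct_eq_zero _ fun g => ?_
    obtain ⟨f, hf⟩ := mem_lastKer_iff.1 (h ▸ Submodule.mem_top : g ∈ lastKer n n 1 T)
    have h1 := congrArg (v ⬝ᵥ ·) hf
    simp only [dotProduct_add, dotProduct_zero, dotProduct_mulVec, ← locM_eq_blockHankel] at h1
    rw [← mulVec_transpose, hH.eq, hv, zero_dotProduct, zero_add, ← mulVec_transpose] at h1
    exact h1
  · intro h
    refine eq_top_iff.2 fun g _ => mem_lastKer_iff.2 ?_
    obtain ⟨f, hf⟩ := Matrix.exists_mulVec_eq_of_forall_ker_transpose (A := locM n p T)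
      (b := -(lastCol n n 1 T *ᵥ g)) fun k hk => by
        rw [hH.eq] at hk
        rw [dotProduct_neg, dotProduct_mulVec, ← mulVec_transpose, h k hk, zero_dotProduct, neg_zero]
    exact ⟨f, by rw [← locM_eq_blockHankel, hf, neg_add_cancel]⟩

/-- The next moment is determined when the kernel of the localizing matrix has full last block. -/
lemma eq_of_lastKer_eq_top (hT : ∀ i, i ≤ 2 * n + 1 → (T i).IsSymm)
    (hT' : ∀ i, i ≤ 2 * n + 1 → (T' i).IsSymm) (h : ∀ i, i ≤ 2 * n → T i = T' i)
    (hR : lastKer (n + 1) n 1 T = ⊤) (hR' : lastKer (n + 1) n 1 T' = ⊤) :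
    T (2 * n + 1) = T' (2 * n + 1) := by
  have hker := (lastKer_eq_top_iff fun i hi => hT i (by omega)).1
    (top_le_iff.1 (hR ▸ lastKer_succ_le))
  refine mulVec_injective (funext fun g => ?_)
  obtain ⟨f, hf⟩ := mem_lastKer_iff.1 (hR ▸ Submodule.mem_top : g ∈ lastKer (n + 1) n 1 T)
  obtain ⟨f', hf'⟩ := mem_lastKer_iff.1 (hR' ▸ Submodule.mem_top : g ∈ lastKer (n + 1) n 1 T')
  obtain ⟨h1, h2⟩ := (locM_succ_mulVec_eq_zero_iff hT f g).1 hf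
  obtain ⟨h1', h2'⟩ := (locM_succ_mulVec_eq_zero_iff hT' f' g).1 hf'
  have hH : locM n p T = locM n p T' := by
    rw [locM_eq_blockHankel, locM_eq_blockHankel, blockHankel_congr h (by omega)]
  rw [← hH, ← lastCol_congr h] at h1'
  rw [← lastCol_congr h] at h2'
  have h3 := hker (f - f') (by
    rw [mulVec_sub, eq_neg_of_add_eq_zero_left h1, eq_neg_of_add_eq_zero_left h1', sub_self])
  rw [mulVec_sub, sub_eq_zero] at h3
  rw [h3] at h2
  exact add_left_cancel (h2.trans h2'.symm)

end Completion

section Measures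

variable {n p : ℕ} {S T' : ℕ → Matrix (Fin p) (Fin p) ℝ}

/-- A minimal representing measure, translated by `t` and split into vectors. -/
lemma exists_vec_of_isRepMeasure {ℓ : ℕ} {x : Fin ℓ → ℝ} {A : Fin ℓ → Matrix (Fin p) (Fin p) ℝ}
    {t : ℝ} {m : ℕ} (h : IsRepMeasure n p S ℓ x A) (hmin : IsMinimal n p S A)
    (hm : MultEq x A t m) :
    ∃ (ξ : (Σ j, Fin (A j).rank) → ℝ) (v : Matrix (Σ j, Fin (A j).rank) (Fin p) ℝ),
      (∀ i, i ≤ 2 * n → shiftT p t S i = vecMoment ξ v i) ∧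
      Fintype.card (Σ j, Fin (A j).rank) = (momentMatrix n p (shiftT p t S)).rank ∧
      {r | ξ r = 0}.ncard = m ∧ ∀ s, massAt x A s = vecMass ξ v (s - t) := by
  obtain ⟨hx, hA, -, hS⟩ := h
  obtain ⟨v, hv, hmass⟩ := exists_vec_of_atoms x hA
  have hS' : ∀ i, i ≤ 2 * n → S i = vecMoment (fun r => x r.1) v i := fun i hi =>
    (hS i hi).trans (hv i)
  refine ⟨fun r => x r.1 - t, v, shiftT_eq_vecMoment t hS', ?_, ?_, fun s => ?_⟩
  · rw [rank_momentMatrix_shiftT t hS', ← hmin, Fintype.card_sigma]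
    simp
  · simpa only [sub_eq_zero] using hm.ncard_eq hx
  · rw [hmass]
    ext b c
    simp only [vecMass, sub_left_inj]

/-- An admissible choice of the next shifted moment yields a minimal representing measure. -/
lemma exists_isRepMeasure_of_completion (hp : 0 < p) {R : Type*} [Fintype R] {ξ₀ : R → ℝ}
    {v₀ : Matrix R (Fin p) ℝ} (t : ℝ) (hS : ∀ i, i ≤ 2 * n → S i = vecMoment ξ₀ v₀ i)
    (hT' : ∀ i, i ≤ 2 * n → T' i = shiftT p t S i) (hsymm : (T' (2 * n + 1)).IsSymm)
    (hker : LinearMap.ker (momentMatrix n p T').mulVecLin ≤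
      LinearMap.ker (locM (n + 1) p T').mulVecLin) {m : ℕ}
    (hm : m + Module.finrank ℝ (lastKer (n + 1) n 0 (shiftT p t S)) =
      (setA n p hp (shiftT p t S)).ncard + Module.finrank ℝ (lastKer (n + 1) n 1 T')) :
    ∃ (k : ℕ) (x : Fin k → ℝ) (A : Fin k → Matrix (Fin p) (Fin p) ℝ),
      IsRepMeasure n p S k x A ∧ IsMinimal n p S A ∧ MultEq x A t m ∧
      shiftT p t (fun i => ∑ j, x j ^ i • A j) (2 * n + 1) = T' (2 * n + 1) := by
  have hT₀ := shiftT_eq_vecMoment t hS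
  have hT'₀ : ∀ i, i ≤ 2 * n → T' i = vecMoment (fun r => ξ₀ r - t) v₀ i := fun i hi =>
    (hT' i hi).trans (hT₀ i hi)
  have hMM : momentMatrix n p T' = momentMatrix n p (shiftT p t S) := by
    rw [momentMatrix_eq_evalMat hT'₀, momentMatrix_eq_evalMat hT₀]
  have hpsd : (momentMatrix n p T').PosSemidef := by
    rw [momentMatrix_eq_evalMat hT'₀, ← conjTranspose_eq_transpose_of_trivial]
    exact posSemidef_conjTranspose_mul_self _
  obtain ⟨η, v, hη⟩ := exists_minimal_vecMoment hpsd (fun i hi => by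
    rcases hi.lt_or_eq with h | rfl
    · rw [hT'₀ i (by omega)]
      exact vecMoment_isSymm _ _ _
    · exact hsymm) hker
  have hTη : ∀ i, i ≤ 2 * n → shiftT p t S i = vecMoment η v i := fun i hi =>
    (hT' i hi).symm.trans (hη i (by omega))
  have hSη : ∀ i, i ≤ 2 * n → S i = vecMoment (fun r => η r + t) v i := fun i hi => by
    have h1 := shiftT_eq_vecMoment (-t) hT₀ i hi
    have h2 := shiftT_eq_vecMoment (-t) hTη i hi
    simp only [sub_neg_eq_add, sub_add_cancel] at h1 h2
    rw [hS i hi, ← h1, h2]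
  have hrank : Fintype.card (Fin (momentMatrix n p T').rank) =
      (momentMatrix n p (shiftT p t S)).rank := by rw [Fintype.card_fin, hMM]
  obtain ⟨k, x, A, hrep, hmin, hmult, hmom⟩ := exists_isRepMeasure_of_vec hSη
    (hrank.trans (rank_momentMatrix_shiftT t hS))
  refine ⟨k, x, A, hrep, hmin, ?_, ?_⟩
  · have h1 := ncard_zero_add_finrank hp hTη hη hrank
    have h2 : {r | η r + t = t} = {r | η r = 0} := by
      ext r
      simp
    obtain rfl : m = {r | η r = 0}.ncard := by omega
    exact h2 ▸ hmult t
  · rw [shiftT_eq_vecMoment (N := 2 * n + 1) t (fun i _ => hmom i) _ le_rfl, hη _ le_rfl]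
    simp

end Measures

section Main

variable {n p : ℕ} {S T : ℕ → Matrix (Fin p) (Fin p) ℝ}

lemma colM2_last_dotProduct (hp : 0 < p) (i : Fin p) (v : Fin n × Fin p → ℝ) :
    colM2 n p hp T ((n + 1) * p + (i.1 + 1)) ⬝ᵥ v = ((lastCol n n 1 T)ᵀ *ᵥ v) i := by
  have := colM2_eq_col (a := n) (s := 1) (T := T) hp (Fin.last n) i
  rw [Fin.val_last] at this
  rw [this]
  rfl

lemma setB_eq_of_lastKer_eq_top (hp : 0 < p) (h : lastKer n n 1 T = ⊤) :
    setB n p hp T = {i | i ∈ Set.Icc 1 p ∧ colM1 n p hp T (n * p + i) ∉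
      Submodule.span ℝ (colM1 n p hp T '' Set.Icc 1 (n * p + i - 1))} := by
  classical
  refine Set.Subset.antisymm (fun j hj => ⟨hj.1, hj.2.2⟩) fun j hj => ⟨hj.1, ?_, hj.2⟩
  obtain ⟨i, rfl⟩ := exists_fin_of_mem_Icc hj.1
  have : IsPivot Fin.val (lastKer n n 1 T) i := by
    rw [h]
    exact ⟨Pi.single i 1, trivial, by simp, fun k hk => Pi.single_eq_of_ne (Fin.ne_of_gt hk) 1⟩
  simpa only [isPivot_lastKer_iff, isPivot_ker_blockHankel_iff hp, Fin.val_last, one_mul] using this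

lemma lastKer_eq_top_iff_dotProduct (hp : 0 < p) (hT : ∀ i, i ≤ 2 * n → (T i).IsSymm) :
    lastKer n n 1 T = ⊤ ↔
      (∀ v, locM n p T *ᵥ v = 0 → ∀ i ∈ setB n p hp T,
        colM2 n p hp T ((n + 1) * p + i) ⬝ᵥ v = 0) ∧
      ∀ v, locM n p T *ᵥ v = 0 → ∀ i ∈ Set.Icc 1 p \ setB n p hp T,
        colM2 n p hp T ((n + 1) * p + i) ⬝ᵥ v = 0 := by
  rw [lastKer_eq_top_iff hT]
  constructor
  · intro h
    have key : ∀ v, locM n p T *ᵥ v = 0 → ∀ i ∈ Set.Icc 1 p,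
        colM2 n p hp T ((n + 1) * p + i) ⬝ᵥ v = 0 := fun v hv j hj => by
      obtain ⟨i, rfl⟩ := exists_fin_of_mem_Icc hj
      rw [colM2_last_dotProduct, h v hv, Pi.zero_apply]
    exact ⟨fun v hv i hi => key v hv i hi.1, fun v hv i hi => key v hv i hi.1⟩
  · rintro ⟨hB, hB'⟩ v hv
    funext i
    rw [← colM2_last_dotProduct hp, Pi.zero_apply]
    by_cases hi : i.1 + 1 ∈ setB n p hp T
    · exact hB v hv _ hi
    · exact hB' v hv _ ⟨⟨by omega, i.2⟩, hi⟩

/-- Two minimal representing measures of the maximal multiplicity coincide when the last blocks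
of the kernel of the localizing matrix fill the whole space. -/
lemma massAt_eq_of_lastKer_eq_top (hp : 0 < p) {t : ℝ} {m : ℕ}
    (htop : lastKer n n 1 (shiftT p t S) = ⊤)
    (hm : m = (setA n p hp (shiftT p t S) ∪ setB n p hp (shiftT p t S)).ncard)
    {ℓ ℓ' : ℕ} {x : Fin ℓ → ℝ} {A : Fin ℓ → Matrix (Fin p) (Fin p) ℝ}
    {x' : Fin ℓ' → ℝ} {A' : Fin ℓ' → Matrix (Fin p) (Fin p) ℝ}
    (hr : IsRepMeasure n p S ℓ x A) (hmin : IsMinimal n p S A) (hmu : MultEq x A t m)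
    (hr' : IsRepMeasure n p S ℓ' x' A') (hmin' : IsMinimal n p S A') (hmu' : MultEq x' A' t m) :
    massAt x A = massAt x' A' := by
  obtain ⟨ξ, v, hT, hc, hξ, hmass⟩ := exists_vec_of_isRepMeasure hr hmin hmu
  obtain ⟨ξ', v', hT', hc', hξ', hmass'⟩ := exists_vec_of_isRepMeasure hr' hmin' hmu'
  have hN := ker_blockHankel_le (ker_mulVecLin_le_of_moments hT fun i _ => rfl) hT
  rw [ncard_setA_union_setB hp hN] at hm
  have hB := ncard_setB (n := n) (T := shiftT p t S) hp
  rw [htop] at hB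
  have hR : lastKer (n + 1) n 1 (vecMoment ξ v) = ⊤ := by
    have := ncard_zero_add_finrank hp hT (fun i _ => rfl) hc
    refine Submodule.eq_top_of_finrank_eq ?_
    rw [← finrank_top ℝ (Fin p → ℝ)]
    omega
  have hR' : lastKer (n + 1) n 1 (vecMoment ξ' v') = ⊤ := by
    have := ncard_zero_add_finrank hp hT' (fun i _ => rfl) hc'
    refine Submodule.eq_top_of_finrank_eq ?_
    rw [← finrank_top ℝ (Fin p → ℝ)]
    omega
  have heq : ∀ i, i ≤ 2 * n → vecMoment ξ v i = vecMoment ξ' v' i := fun i hi =>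
    (hT i hi).symm.trans (hT' i hi)
  have hlast := eq_of_lastKer_eq_top (fun i _ => vecMoment_isSymm ξ v i)
    (fun i _ => vecMoment_isSymm ξ' v' i) heq hR hR'
  have hMM : momentMatrix n p (vecMoment ξ v) = momentMatrix n p (shiftT p t S) := by
    rw [momentMatrix_eq_evalMat hT, momentMatrix_eq_evalMat fun i _ => rfl]
  funext s
  rw [hmass, hmass', vecMass_eq_of_moments_eq (n := n) (fun i _ => rfl) (fun i hi => ?_)
    (hMM ▸ hc) (hMM ▸ hc')]
  rcases hi.lt_or_eq with h | rfl
  · exact heq i (by omega)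
  · exact hlast

/-- The representing measures of multiplicity `m` come in a line unless the last blocks of the
kernel of the localizing matrix fill the whole space and `m` is maximal. -/
lemma lastKer_eq_top_of_unique (hp : 0 < p) {R : Type*} [Fintype R] {ξ : R → ℝ}
    {v : Matrix R (Fin p) ℝ} (hS : ∀ i, i ≤ 2 * n → S i = vecMoment ξ v i) {t : ℝ} {m : ℕ}
    (hm₁ : (setA n p hp (shiftT p t S)).ncard ≤ m)
    (hm₂ : m ≤ (setA n p hp (shiftT p t S) ∪ setB n p hp (shiftT p t S)).ncard)
    (huniq : ∀ (ℓ : ℕ) (x : Fin ℓ → ℝ) (A : Fin ℓ → Matrix (Fin p) (Fin p) ℝ)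
        (ℓ' : ℕ) (x' : Fin ℓ' → ℝ) (A' : Fin ℓ' → Matrix (Fin p) (Fin p) ℝ),
        IsRepMeasure n p S ℓ x A → IsMinimal n p S A → MultEq x A t m →
        IsRepMeasure n p S ℓ' x' A' → IsMinimal n p S A' → MultEq x' A' t m →
        massAt x A = massAt x' A') :
    lastKer n n 1 (shiftT p t S) = ⊤ ∧
      m = (setA n p hp (shiftT p t S) ∪ setB n p hp (shiftT p t S)).ncard := by
  let T₀ := vecMoment (fun r => ξ r - t) v
  have hT : ∀ i, i ≤ 2 * n → shiftT p t S i = T₀ i := shiftT_eq_vecMoment t hS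
  have hK := ker_mulVecLin_le_of_moments hT fun i (_ : i ≤ 2 * n + 1) => rfl
  have hT₀s : ∀ i, (T₀ i).IsSymm := vecMoment_isSymm _ _
  have hTs : ∀ i, i ≤ 2 * n → (shiftT p t S i).IsSymm := fun i hi => hT i hi ▸ hT₀s i
  have hU := ncard_setA_union_setB hp (ker_blockHankel_le hK hT)
  have hB := ncard_setB (n := n) (T := shiftT p t S) hp
  obtain ⟨E, hLE, hEG, hE⟩ := Submodule.exists_between_finrank_eq
    (lastKer_zero_le (n := n) (T := shiftT p t S))
    (Module.finrank ℝ (lastKer (n + 1) n 0 (shiftT p t S)) +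
      (m - (setA n p hp (shiftT p t S)).ncard)) (by omega) (by omega)
  obtain ⟨Z, Q, hZ, hQ, hQE, hQ0, hZ0, hline⟩ := Matrix.exists_completion_line
    (locM n p (shiftT p t S)) (locM_isSymm hTs) (lastCol n n 1 (shiftT p t S))
    (T₀ (2 * n + 1)) (hT₀s _) E fun g hg => mem_lastKer_iff.1 (hEG hg)
  let T' : ℝ → ℕ → Matrix (Fin p) (Fin p) ℝ := fun ε =>
    Function.update (shiftT p t S) (2 * n + 1) (Z + ε • Q)
  have hT'lt : ∀ ε, ∀ i, i ≤ 2 * n → T' ε i = shiftT p t S i := fun ε i hi =>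
    Function.update_of_ne (by omega) _ _
  have hT'eq : ∀ ε, T' ε (2 * n + 1) = Z + ε • Q := fun ε => Function.update_self _ _ _
  have hT'top : ∀ ε, (T' ε (2 * n + 1)).IsSymm := fun ε => by
    rw [hT'eq]
    exact hZ.add (hQ.smul ε)
  have hT's : ∀ ε, ∀ i, i ≤ 2 * n + 1 → (T' ε i).IsSymm := fun ε i hi => by
    rcases hi.lt_or_eq with h | rfl
    · rw [hT'lt ε i (by omega)]
      exact hTs i (by omega)
    · exact hT'top ε
  have hloc : ∀ ε, locM n p (T' ε) = locM n p (shiftT p t S) := fun ε => by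
    rw [locM_eq_blockHankel, locM_eq_blockHankel, blockHankel_congr (hT'lt ε) (by omega)]
  have hcol : ∀ ε, lastCol n n 1 (T' ε) = lastCol n n 1 (shiftT p t S) := fun ε =>
    lastCol_congr (hT'lt ε)
  have hR : ∀ ε, ε ≠ 0 → lastKer (n + 1) n 1 (T' ε) = E := fun ε hε => by
    ext g
    simp only [mem_lastKer_iff, locM_succ_mulVec_eq_zero_iff (hT's ε), hloc, hcol, hT'eq]
    exact hline ε hε g
  have hker : ∀ ε, LinearMap.ker (momentMatrix n p (T' ε)).mulVecLin ≤
      LinearMap.ker (locM (n + 1) p (T' ε)).mulVecLin := fun ε F hF => by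
    have hMM : momentMatrix n p (T' ε) = momentMatrix n p (shiftT p t S) := by
      rw [momentMatrix_eq_blockHankel, momentMatrix_eq_blockHankel,
        blockHankel_congr (hT'lt ε) (by omega)]
    rw [hMM] at hF
    have hg : lastBlock n p F ∈ E := hLE ⟨F, hF, rfl⟩
    have h0 := (blockHankel_succ_mulVec (T := T₀) F).symm.trans (hK hF)
    rw [locM_succ_mulVec_eq_zero_iff fun i _ => hT₀s i] at h0
    rw [← lastCol_congr hT, locM_eq_blockHankel, ← blockHankel_congr hT (by omega),
      ← locM_eq_blockHankel] at h0
    refine (blockHankel_succ_mulVec (T := T' ε) F).trans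
      ((locM_succ_mulVec_eq_zero_iff (hT's ε) _ _).2 ?_)
    rw [hloc, hcol, hT'eq, add_mulVec, smul_mulVec, hQ0 _ hg, smul_zero, add_zero]
    exact ⟨h0.1, hZ0 _ _ hg h0.1 h0.2⟩
  have hmeas := fun ε (hε : ε ≠ 0) => exists_isRepMeasure_of_completion hp t hS (hT'lt ε)
    (hT'top ε) (hker ε) (m := m) (by rw [hR ε hε]; omega)
  obtain ⟨k, x, A, hr, hmin, hmu, hmom⟩ := hmeas 1 one_ne_zero
  obtain ⟨k', x', A', hr', hmin', hmu', hmom'⟩ := hmeas 2 two_ne_zero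
  have hmass := huniq k x A k' x' A' hr hmin hmu hr' hmin' hmu'
  rw [funext fun i => sum_pow_smul_eq_of_massAt_eq hmass i, hmom', hT'eq, hT'eq, add_right_inj,
    one_smul, two_smul, add_eq_left] at hmom
  have htop := hQE hmom
  rw [htop] at hEG hE
  have hG := top_le_iff.1 hEG
  refine ⟨hG, ?_⟩
  rw [hG] at hB
  omega

end Main

/-- **Theorem 1.1, moreover part**: under `#A ≤ m ≤ #(A ∪ B)`, the minimal representing
measure with multiplicity `m` at `t` is unique iff the four conditions (1.2) hold. -/
theorem main_theorem_uniqueness (n p : ℕ) (hn : 1 ≤ n) (hp : 0 < p)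
    (S : ℕ → Matrix (Fin p) (Fin p) ℝ) (hsymm : ∀ i, i ≤ 2 * n → (S i).IsSymm)
    (hrep : ∃ ℓ x A, IsRepMeasure n p S ℓ x A)
    (t : ℝ) (m : ℕ)
    (hm₁ : (setA n p hp (shiftT p t S)).ncard ≤ m)
    (hm₂ : m ≤ (setA n p hp (shiftT p t S) ∪ setB n p hp (shiftT p t S)).ncard) :
    (∀ (ℓ : ℕ) (x : Fin ℓ → ℝ) (A : Fin ℓ → Matrix (Fin p) (Fin p) ℝ)
        (ℓ' : ℕ) (x' : Fin ℓ' → ℝ) (A' : Fin ℓ' → Matrix (Fin p) (Fin p) ℝ),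
        IsRepMeasure n p S ℓ x A → IsMinimal n p S A → MultEq x A t m →
        IsRepMeasure n p S ℓ' x' A' → IsMinimal n p S A' → MultEq x' A' t m →
        massAt x A = massAt x' A') ↔
      (setB n p hp (shiftT p t S) =
          {i | i ∈ Set.Icc 1 p ∧
            colM1 n p hp (shiftT p t S) (n * p + i) ∉
              Submodule.span ℝ
                (colM1 n p hp (shiftT p t S) '' Set.Icc 1 (n * p + i - 1))} ∧
        m = (setA n p hp (shiftT p t S) ∪ setB n p hp (shiftT p t S)).ncard ∧
        (∀ v : Fin n × Fin p → ℝ, (locM n p (shiftT p t S)).mulVec v = 0 →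
          ∀ i ∈ setB n p hp (shiftT p t S),
            dotProduct (colM2 n p hp (shiftT p t S) ((n + 1) * p + i)) v = 0) ∧
        (∀ v : Fin n × Fin p → ℝ, (locM n p (shiftT p t S)).mulVec v = 0 →
          ∀ i ∈ Set.Icc 1 p \ setB n p hp (shiftT p t S),
            dotProduct (colM2 n p hp (shiftT p t S) ((n + 1) * p + i)) v = 0)) := by
  obtain ⟨ℓ, x, A, hx, hA, -, hS⟩ := hrep
  obtain ⟨v, hv, -⟩ := exists_vec_of_atoms x hA
  have hS' : ∀ i, i ≤ 2 * n → S i = vecMoment (fun r => x r.1) v i := fun i hi =>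
    (hS i hi).trans (hv i)
  have hTs : ∀ i, i ≤ 2 * n → (shiftT p t S i).IsSymm := fun i hi => by
    rw [shiftT_eq_vecMoment t hS' i hi]
    exact vecMoment_isSymm _ _ _
  constructor
  · intro huniq
    obtain ⟨htop, hm⟩ := lastKer_eq_top_of_unique hp hS' hm₁ hm₂ huniq
    exact ⟨setB_eq_of_lastKer_eq_top hp htop, hm, (lastKer_eq_top_iff_dotProduct hp hTs).1 htop⟩
  · rintro ⟨-, hm, h34⟩ ℓ x A ℓ' x' A' hr hmin hmu hr' hmin' hmu'
    exact massAt_eq_of_lastKer_eq_top hp ((lastKer_eq_top_iff_dotProduct hp hTs).2 h34) hm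
      hr hmin hmu hr' hmin' hmu'
end
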